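/- (Theorem 5.4: deformation of the subdivided equilateral triangle.) Let n ≥ 2 and α ∈ [π/6, π/2]. Then there exists a continuously differentiable family w : [0,1] → (V → ℝ) with w(0) = 0 such that for every t ∈ [0,1]: the scaled metric w(t)*l_st is a PL metric (every triangle satisfies the strict triangle inequalities); (a) K_A(w(t)) = −tα + (2 + t)·π/3, i.e. the angle at A equals tα + (1 − t)·π/3; (b) K_v(w(t)) = 0 for every vertex v ∉ {A} ∪ V₀; (c) w(t)(v) = 0 for every v ∈ V₀; (d) every inner angle of every triangle in the metric w(t)*l_st lies in the interval [π/3 − |α − π/3|, π/3 + |α − π/3|]; (e) every inner angle at a vertex other than A is at most 59π/120; (f) |K_v(w(t)) − K_v(0)| ≤ 2000/√(ln n) for every vertex v ≠ A, and Σ_{v ∈ V₀} |K_v(w(t)) − K_v(0)| ≤ π/6. -/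

import Mathlib

open Real
open scoped Classical

/-- The inner angle opposite the side of length `r` in a triangle with side lengths
`p`, `q`, `r` (law of cosines). -/
noncomputable def triAngle (p q r : ℝ) : ℝ :=
  Real.arccos ((p ^ 2 + q ^ 2 - r ^ 2) / (2 * p * q))

/-- Strict triangle inequalities for three side lengths. -/
def StrictTri (p q r : ℝ) : Prop := p < q + r ∧ q < p + r ∧ r < p + q

/-- The vertex set of the `n`-th standard subdivision of an equilateral triangle:
`{(i,j) : 0 ≤ i, 0 ≤ j, i + j ≤ n}` (coordinates taken in `ℤ`). -/
def inV (n : ℕ) (v : ℤ × ℤ) : Prop :=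
  0 ≤ v.1 ∧ 0 ≤ v.2 ∧ v.1 + v.2 ≤ (n : ℤ)

/-- `p` is the base point of a 'down' triangle `{p, p+(1,0), p+(0,1)}`. -/
def validDown (n : ℕ) (p : ℤ × ℤ) : Prop :=
  0 ≤ p.1 ∧ 0 ≤ p.2 ∧ p.1 + p.2 + 1 ≤ (n : ℤ)

/-- `p` is the base point of an 'up' triangle `{p+(1,0), p+(0,1), p+(1,1)}`. -/
def validUp (n : ℕ) (p : ℤ × ℤ) : Prop :=
  0 ≤ p.1 ∧ 0 ≤ p.2 ∧ p.1 + p.2 + 2 ≤ (n : ℤ)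

/-- The vertex-scaled length of the edge `pq` (every edge has length `1/n` in `l_st`). -/
noncomputable def el (n : ℕ) (w : ℤ × ℤ → ℝ) (p q : ℤ × ℤ) : ℝ :=
  Real.exp (w p + w q) / n

/-- The inner angle at the vertex `a` in the triangle with vertices `a, b, c`
in the metric `w*l_st`. -/
noncomputable def angAt (n : ℕ) (w : ℤ × ℤ → ℝ) (a b c : ℤ × ℤ) : ℝ :=
  triAngle (el n w a b) (el n w a c) (el n w b c)

/-- The angle sum `Θ_v(w)` at the vertex `v`: the sum of the inner angles at `v`
over the (at most six) triangles of the subdivision containing `v`. -/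
noncomputable def angSum (n : ℕ) (w : ℤ × ℤ → ℝ) (v : ℤ × ℤ) : ℝ :=
  (if validDown n v then angAt n w v (v + (1, 0)) (v + (0, 1)) else 0) +
  (if validDown n (v - (1, 0)) then angAt n w v (v - (1, 0)) (v + (-1, 1)) else 0) +
  (if validDown n (v - (0, 1)) then angAt n w v (v - (0, 1)) (v + (1, -1)) else 0) +
  (if validUp n (v - (1, 0)) then angAt n w v (v + (-1, 1)) (v + (0, 1)) else 0) +
  (if validUp n (v - (0, 1)) then angAt n w v (v + (1, -1)) (v + (1, 0)) else 0) +
  (if validUp n (v - (1, 1)) then angAt n w v (v - (0, 1)) (v - (1, 0)) else 0)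

/-- Boundary vertices of the subdivided triangle. -/
def isBdry (n : ℕ) (v : ℤ × ℤ) : Prop :=
  v.1 = 0 ∨ v.2 = 0 ∨ v.1 + v.2 = (n : ℤ)

/-- The discrete curvature `K_v(w)`: `π` minus the angle sum at boundary vertices,
`2π` minus the angle sum at interior vertices. -/
noncomputable def Kcurv (n : ℕ) (w : ℤ × ℤ → ℝ) (v : ℤ × ℤ) : ℝ :=
  if isBdry n v then π - angSum n w v else 2 * π - angSum n w v

/-- All inner angles of all triangles of the subdivision, in the metric `w*l_st`,
lie in the set `S`. -/
def AllAnglesIn (n : ℕ) (w : ℤ × ℤ → ℝ) (S : Set ℝ) : Prop :=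
  (∀ p : ℤ × ℤ, validDown n p →
    angAt n w p (p + (1, 0)) (p + (0, 1)) ∈ S ∧
    angAt n w (p + (1, 0)) p (p + (0, 1)) ∈ S ∧
    angAt n w (p + (0, 1)) p (p + (1, 0)) ∈ S) ∧
  (∀ p : ℤ × ℤ, validUp n p →
    angAt n w (p + (1, 0)) (p + (0, 1)) (p + (1, 1)) ∈ S ∧
    angAt n w (p + (0, 1)) (p + (1, 0)) (p + (1, 1)) ∈ S ∧
    angAt n w (p + (1, 1)) (p + (1, 0)) (p + (0, 1)) ∈ S)

/-- All inner angles at vertices other than `A = (0,0)` are at most `bd`. -/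
def AnglesAwayFromABounded (n : ℕ) (w : ℤ × ℤ → ℝ) (bd : ℝ) : Prop :=
  (∀ p : ℤ × ℤ, validDown n p →
    (p ≠ (0, 0) → angAt n w p (p + (1, 0)) (p + (0, 1)) ≤ bd) ∧
    (p + (1, 0) ≠ (0, 0) → angAt n w (p + (1, 0)) p (p + (0, 1)) ≤ bd) ∧
    (p + (0, 1) ≠ (0, 0) → angAt n w (p + (0, 1)) p (p + (1, 0)) ≤ bd)) ∧
  (∀ p : ℤ × ℤ, validUp n p →
    (p + (1, 0) ≠ (0, 0) → angAt n w (p + (1, 0)) (p + (0, 1)) (p + (1, 1)) ≤ bd) ∧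
    (p + (0, 1) ≠ (0, 0) → angAt n w (p + (0, 1)) (p + (1, 0)) (p + (1, 1)) ≤ bd) ∧
    (p + (1, 1) ≠ (0, 0) → angAt n w (p + (1, 1)) (p + (1, 0)) (p + (0, 1)) ≤ bd))

/-- Every triangle of the subdivision satisfies the strict triangle inequalities in the
metric `w*l_st` (so `w*l_st` is a PL metric). -/
def IsPLMetric (n : ℕ) (w : ℤ × ℤ → ℝ) : Prop :=
  (∀ p : ℤ × ℤ, validDown n p →
    StrictTri (el n w p (p + (1, 0))) (el n w p (p + (0, 1)))
      (el n w (p + (1, 0)) (p + (0, 1)))) ∧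
  (∀ p : ℤ × ℤ, validUp n p →
    StrictTri (el n w (p + (1, 0)) (p + (0, 1))) (el n w (p + (1, 0)) (p + (1, 1)))
      (el n w (p + (0, 1)) (p + (1, 1))))

section ODE

open Set Topology

variable {E : Type*} [NormedAddCommGroup E] [NormedSpace ℝ E] [FiniteDimensional ℝ E]

/-- A vector field which is `C¹` near a compact set agrees on that set with a compactly supported
`C¹` vector field. -/
lemma exists_contDiff_hasCompactSupport_eqOn (F : E → E) {K : Set E} (hK : IsCompact K)
    (hF : ∀ x ∈ K, ContDiffAt ℝ 1 F x) :
    ∃ H : E → E, ContDiff ℝ 1 H ∧ HasCompactSupport H ∧ EqOn H F K := by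
  have hU : IsOpen {x | ContDiffAt ℝ 1 F x} :=
    isOpen_iff_mem_nhds.2 fun x hx =>
      ContDiffAt.eventually (show ContDiffAt ℝ 1 F x from hx) (by simp)
  obtain ⟨L, hL, hKL, hLU⟩ := exists_compact_between hK hU hF
  obtain ⟨f, hf0, hf1, -⟩ := exists_contMDiffMap_zero_one_of_isClosed (n := 1)
    (modelWithCornersSelf ℝ E) (isOpen_interior (s := L)).isClosed_compl hK.isClosed
    (disjoint_compl_left_iff_subset.2 hKL)
  have hfc : ContDiff ℝ 1 (f : E → ℝ) := f.contMDiff.contDiff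
  have hzero : ∀ x, x ∉ L → f x = 0 := fun x hx => hf0 fun h => hx (interior_subset h)
  refine ⟨fun x => f x • F x, ?_, ?_, fun x hx => ?_⟩
  · refine contDiff_iff_contDiffAt.2 fun x => ?_
    by_cases hx : x ∈ L
    · exact hfc.contDiffAt.smul (hLU hx)
    · refine (contDiffAt_const (c := (0 : E))).congr_of_eventuallyEq ?_
      filter_upwards [hL.isClosed.isOpen_compl.mem_nhds hx] with y hy
      simp [hzero y hy]
  · refine HasCompactSupport.intro hL fun x hx => ?_
    simp [hzero x hx]
  · simp [hf1 hx]

/-- Global integral curves, on the unit time interval, of a vector field which is `C¹` near a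
compact set `K`; the equation is only guaranteed while the curve is in `K`. -/
lemma exists_integralCurve_of_isCompact (F : E → E) {K : Set E} (hK : IsCompact K)
    (hF : ∀ x ∈ K, ContDiffAt ℝ 1 F x) (x₀ : E) :
    ∃ x : ℝ → E, x 0 = x₀ ∧ ContDiffOn ℝ 1 x (Icc 0 1) ∧
      ∀ t ∈ Icc (0 : ℝ) 1, x t ∈ K → HasDerivWithinAt x (F (x t)) (Icc 0 1) t := by
  obtain ⟨H, hH, hHc, hHF⟩ := exists_contDiff_hasCompactSupport_eqOn F hK hF
  obtain ⟨C, hC⟩ := hH.lipschitzWith_of_hasCompactSupport hHc one_ne_zero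
  obtain ⟨B, hB⟩ := hHc.exists_bound_of_continuous hH.continuous
  have hpl : IsPicardLindelof (fun _ : ℝ => H) (tmin := 0) (tmax := 1) ⟨0, by simp⟩ x₀
      (B.toNNReal) 0 (B.toNNReal) C :=
    IsPicardLindelof.of_time_independent
      (fun x _ => (hB x).trans (Real.le_coe_toNNReal B)) (hC.lipschitzOnWith) (by simp)
  obtain ⟨x, hx0, hx⟩ := hpl.exists_eq_forall_mem_Icc_hasDerivWithinAt₀
  refine ⟨x, hx0, ?_, fun t ht hxt => hHF hxt ▸ hx t ht⟩
  exact ODE.contDiffOn_enat_Icc_of_hasDerivWithinAt (n := 1) (f := fun _ => H) (u := univ)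
    (hH.comp contDiff_snd).contDiffOn hx (mapsTo_univ _ _)

/-- A curve which starts in a closed set `K`, and which at every time before `1` is interior to `K`
provided it has been in `K` so far, stays in `K` during the unit time interval. -/
lemma forall_mem_of_mem_interior {X : Type*} [TopologicalSpace X] {x : ℝ → X}
    (hx : ContinuousOn x (Icc 0 1)) {K : Set X} (hK : IsClosed K) (h0 : x 0 ∈ K)
    (h : ∀ s ∈ Ico (0 : ℝ) 1, (∀ τ ∈ Icc 0 s, x τ ∈ K) → x s ∈ interior K) :
    ∀ t ∈ Icc (0 : ℝ) 1, x t ∈ K := by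
  have hcl : IsClosed ((x ⁻¹' K) ∩ Icc 0 1) := by
    rw [inter_comm]; exact hx.preimage_isClosed_of_isClosed isClosed_Icc hK
  refine hcl.Icc_subset_of_forall_mem_nhdsGT_of_Icc_subset h0 fun t ht hsub => ?_
  have hc : ContinuousWithinAt x (Ioi t) t :=
    (hx t (Ico_subset_Icc_self ht)).mono_of_mem_nhdsWithin (Icc_mem_nhdsGT_of_mem ht)
  exact hc (mem_interior_iff_mem_nhds.1 (h t ht hsub))

end ODE

section Combinatorics

/-- The vertices of the subdivision, as a finset. -/
noncomputable def verts (n : ℕ) : Finset (ℤ × ℤ) :=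
  (Finset.Icc (0 : ℤ) n ×ˢ Finset.Icc (0 : ℤ) n).filter (inV n)

/-- The triangles of the subdivision. Each one is recorded as `(a, b, c)` with `a` on its axis
parallel to the symmetry axis, so that the reflection `Prod.swap` maps `(a, b, c)` to the triangle
`(a.swap, c.swap, b.swap)`. -/
noncomputable def tris (n : ℕ) : Finset ((ℤ × ℤ) × (ℤ × ℤ) × (ℤ × ℤ)) :=
  ((verts n).filter (validDown n)).image (fun p => (p, p + (1, 0), p + (0, 1))) ∪
    ((verts n).filter (validUp n)).image (fun p => (p + (1, 1), p + (1, 0), p + (0, 1)))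

/-- The sum of a function of corners over all the corners at the vertex `v`. -/
noncomputable def cornerSum (n : ℕ) (f : ℤ × ℤ → ℤ × ℤ → ℤ × ℤ → ℝ) (v : ℤ × ℤ) : ℝ :=
  ∑ t ∈ tris n, ((if t.1 = v then f t.1 t.2.1 t.2.2 else 0) +
    (if t.2.1 = v then f t.2.1 t.1 t.2.2 else 0) + (if t.2.2 = v then f t.2.2 t.1 t.2.1 else 0))

lemma mem_verts {n : ℕ} {v : ℤ × ℤ} : v ∈ verts n ↔ inV n v := by
  simp only [verts, inV, Finset.mem_filter, Finset.mem_product, Finset.mem_Icc]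
  omega

lemma mem_verts_of_validDown {n : ℕ} {v : ℤ × ℤ} (h : validDown n v) : v ∈ verts n := by
  simp only [mem_verts, inV, validDown] at *; omega

lemma mem_verts_of_validUp {n : ℕ} {v : ℤ × ℤ} (h : validUp n v) : v ∈ verts n := by
  simp only [mem_verts, inV, validUp] at *; omega

lemma mem_tris {n : ℕ} {a b c : ℤ × ℤ} : (a, b, c) ∈ tris n ↔
    (validDown n a ∧ b = a + (1, 0) ∧ c = a + (0, 1)) ∨
    (validUp n (a - (1, 1)) ∧ b = a - (0, 1) ∧ c = a - (1, 0)) := by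
  obtain ⟨a₁, a₂⟩ := a
  obtain ⟨b₁, b₂⟩ := b
  obtain ⟨c₁, c₂⟩ := c
  simp only [tris, Finset.mem_union, Finset.mem_image, Finset.mem_filter, Prod.mk.injEq,
    Prod.exists,
    mem_verts, inV, validDown, validUp, Prod.mk_add_mk, Prod.mk_sub_mk]
  constructor
  · rintro (⟨x, y, h⟩ | ⟨x, y, h⟩)
    · left; omega
    · right; omega
  · rintro (h | h)
    · exact Or.inl ⟨a₁, a₂, by omega⟩
    · exact Or.inr ⟨a₁ - 1, a₂ - 1, by omega⟩

lemma down_mem_tris {n : ℕ} {p : ℤ × ℤ} (h : validDown n p) :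
    (p, p + (1, 0), p + (0, 1)) ∈ tris n := mem_tris.2 (Or.inl ⟨h, rfl, rfl⟩)

lemma up_mem_tris {n : ℕ} {p : ℤ × ℤ} (h : validUp n p) :
    (p + (1, 1), p + (1, 0), p + (0, 1)) ∈ tris n :=
  Finset.mem_union_right _ (Finset.mem_image.2
    ⟨p, Finset.mem_filter.2 ⟨mem_verts_of_validUp h, h⟩, rfl⟩)

lemma inV_of_mem_tris {n : ℕ} {a b c : ℤ × ℤ} (h : (a, b, c) ∈ tris n) :
    inV n a ∧ inV n b ∧ inV n c := by
  rcases mem_tris.1 h with ⟨h, rfl, rfl⟩ | ⟨h, rfl, rfl⟩ <;>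
    simp only [inV, validDown, validUp, Prod.fst_add, Prod.snd_add, Prod.fst_sub,
      Prod.snd_sub] at * <;>
    omega

lemma ne_zero_of_mem_tris {n : ℕ} {a b c : ℤ × ℤ} (h : (a, b, c) ∈ tris n) :
    b ≠ (0, 0) ∧ c ≠ (0, 0) := by
  rcases mem_tris.1 h with ⟨h, rfl, rfl⟩ | ⟨h, rfl, rfl⟩ <;>
    simp only [validDown, validUp, Prod.ext_iff, Prod.fst_add, Prod.snd_add, Prod.fst_sub,
      Prod.snd_sub, ne_eq] at * <;>
    omega

lemma swap_mem_tris {n : ℕ} {a b c : ℤ × ℤ} (h : (a, b, c) ∈ tris n) :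
    (a.swap, c.swap, b.swap) ∈ tris n := by
  obtain ⟨a₁, a₂⟩ := a
  obtain ⟨b₁, b₂⟩ := b
  obtain ⟨c₁, c₂⟩ := c
  simp only [mem_tris, validDown, validUp, Prod.ext_iff, Prod.fst_add, Prod.snd_add, Prod.fst_sub,
      Prod.snd_sub, Prod.swap] at *
  omega

lemma sum_tris_swap {n : ℕ} (f : ℤ × ℤ → ℤ × ℤ → ℤ × ℤ → ℝ) :
    ∑ t ∈ tris n, f t.1.swap t.2.2.swap t.2.1.swap = ∑ t ∈ tris n, f t.1 t.2.1 t.2.2 :=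
  Finset.sum_nbij' (fun t => (t.1.swap, t.2.2.swap, t.2.1.swap))
    (fun t => (t.1.swap, t.2.2.swap, t.2.1.swap)) (fun _ h => swap_mem_tris h)
    (fun _ h => swap_mem_tris h) (by simp) (by simp) (by simp)

lemma sum_tris {n : ℕ} (f : (ℤ × ℤ) × (ℤ × ℤ) × (ℤ × ℤ) → ℝ) :
    ∑ t ∈ tris n, f t =
      ∑ p ∈ (verts n).filter (validDown n), f (p, p + (1, 0), p + (0, 1)) +
      ∑ p ∈ (verts n).filter (validUp n), f (p + (1, 1), p + (1, 0), p + (0, 1)) := by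
  rw [tris, Finset.sum_union, Finset.sum_image, Finset.sum_image]
  · intro p _ q _ h; simpa using congrArg Prod.fst h
  · intro p _ q _ h; simpa using congrArg Prod.fst h
  · rw [Finset.disjoint_left]
    intro t h h'
    simp only [Finset.mem_image] at h h'
    obtain ⟨p, -, rfl⟩ := h
    obtain ⟨q, -, h⟩ := h'
    simp only [Prod.ext_iff, Prod.fst_add, Prod.snd_add] at h
    omega

lemma sum_ite_add_eq {s : Finset (ℤ × ℤ)} (v d : ℤ × ℤ) (g : ℤ × ℤ → ℝ) :
    ∑ p ∈ s, (if p + d = v then g p else 0) = if v - d ∈ s then g (v - d) else 0 := by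
  simp_rw [← eq_sub_iff_add_eq]
  rw [Finset.sum_ite_eq']

lemma cornerSum_eq (n : ℕ) (f : ℤ × ℤ → ℤ × ℤ → ℤ × ℤ → ℝ) (hf : ∀ a b c, f a b c = f a c b)
    (v : ℤ × ℤ) : cornerSum n f v =
      (if validDown n v then f v (v + (1, 0)) (v + (0, 1)) else 0) +
      (if validDown n (v - (1, 0)) then f v (v - (1, 0)) (v + (-1, 1)) else 0) +
      (if validDown n (v - (0, 1)) then f v (v - (0, 1)) (v + (1, -1)) else 0) +
      (if validUp n (v - (1, 0)) then f v (v + (-1, 1)) (v + (0, 1)) else 0) +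
      (if validUp n (v - (0, 1)) then f v (v + (1, -1)) (v + (1, 0)) else 0) +
      (if validUp n (v - (1, 1)) then f v (v - (0, 1)) (v - (1, 0)) else 0) := by
  have hd : ∀ p, p ∈ (verts n).filter (validDown n) ↔ validDown n p := fun p => by
    simpa using mem_verts_of_validDown
  have hu : ∀ p, p ∈ (verts n).filter (validUp n) ↔ validUp n p := fun p => by
    simpa using mem_verts_of_validUp
  rw [cornerSum, sum_tris]
  simp only [Finset.sum_add_distrib, sum_ite_add_eq, hd, hu, Finset.sum_ite_eq']
  obtain ⟨i, j⟩ := v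
  simp only [Prod.mk_add_mk, Prod.mk_sub_mk]
  simp only [add_zero, sub_zero, sub_add_cancel, ← sub_eq_add_neg]
  rw [hf (i, j) (i - 1, j + 1) (i, j + 1), hf (i, j) (i + 1, j - 1) (i + 1, j)]
  ring

lemma sum_mul_cornerSum (n : ℕ) (f : ℤ × ℤ → ℤ × ℤ → ℤ × ℤ → ℝ) (φ : ℤ × ℤ → ℝ) :
    ∑ v ∈ verts n, φ v * cornerSum n f v =
      ∑ t ∈ tris n, (φ t.1 * f t.1 t.2.1 t.2.2 + φ t.2.1 * f t.2.1 t.1 t.2.2 +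
        φ t.2.2 * f t.2.2 t.1 t.2.1) := by
  simp only [cornerSum, Finset.mul_sum]
  rw [Finset.sum_comm]
  refine Finset.sum_congr rfl fun t ht => ?_
  obtain ⟨a, b, c⟩ := t
  have h := inV_of_mem_tris ht
  simp only [← mem_verts] at h
  simp [mul_add, Finset.sum_add_distrib, h.1, h.2.1, h.2.2]

lemma cornerSum_swap (n : ℕ) (f : ℤ × ℤ → ℤ × ℤ → ℤ × ℤ → ℝ) (hf : ∀ a b c, f a b c = f a c b)
    (hs : ∀ a b c, f a.swap b.swap c.swap = f a b c) (v : ℤ × ℤ) :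
    cornerSum n f v.swap = cornerSum n f v := by
  rw [cornerSum, cornerSum, ← sum_tris_swap (fun a b c => (if a = v.swap then f a b c else 0) +
    (if b = v.swap then f b a c else 0) + (if c = v.swap then f c a b else 0))]
  refine Finset.sum_congr rfl fun t _ => ?_
  simp only [hs, Prod.swap_inj]
  rw [hf t.1 t.2.2, add_right_comm]

/-- A function which is constant along the edges of the subdivision is constant. -/
lemma eq_zero_of_edges {n : ℕ} {φ : ℤ × ℤ → ℝ}
    (h : ∀ a b c, (a, b, c) ∈ tris n → φ a = φ b ∧ φ a = φ c) {v : ℤ × ℤ} (hv : inV n v) :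
    φ v = φ (0, 0) := by
  have key : ∀ k : ℕ, ∀ v : ℤ × ℤ, inV n v → v.1 + v.2 = k → φ v = φ (0, 0) := by
    intro k
    induction k with
    | zero =>
      rintro ⟨i, j⟩ hv h0
      simp only [inV] at hv h0
      rw [show i = 0 by omega, show j = 0 by omega]
    | succ k ih =>
      rintro ⟨i, j⟩ hv h0
      simp only [inV] at hv h0
      push_cast at h0
      rcases lt_or_ge 0 i with hi | hi
      · have hp : validDown n (i - 1, j) := by simp only [validDown]; omega
        have := (h _ _ _ (down_mem_tris hp)).1
        simp only [Prod.mk_add_mk, sub_add_cancel, add_zero] at this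
        rw [← this]
        exact ih _ (by simp only [inV]; omega) (by simp only; omega)
      · have hp : validDown n (i, j - 1) := by simp only [validDown]; omega
        have := (h _ _ _ (down_mem_tris hp)).2
        simp only [Prod.mk_add_mk, sub_add_cancel, add_zero] at this
        rw [← this]
        exact ih _ (by simp only [inV]; omega) (by simp only; omega)
  exact key (v.1 + v.2).toNat v hv (by have := hv.1; have := hv.2.1; omega)

/-- `v` is a corner of the triangle of the subdivision with vertices `v`, `y`, `z`. -/
def CornerOf (n : ℕ) (v y z : ℤ × ℤ) : Prop :=
  (v, y, z) ∈ tris n ∨ (y, v, z) ∈ tris n ∨ (y, z, v) ∈ tris n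

end Combinatorics

section Flow

/-- The contribution of the triangle `a b c` to the Dirichlet form with cotangent weights `κ`
(`κ a b c` being the weight of the angle at `a`). -/
def energy (κ : ℤ × ℤ → ℤ × ℤ → ℤ × ℤ → ℝ) (U φ : ℤ × ℤ → ℝ) (a b c : ℤ × ℤ) : ℝ :=
  κ c a b * ((U a - U b) * (φ a - φ b)) + κ b a c * ((U a - U c) * (φ a - φ c)) +
    κ a b c * ((U b - U c) * (φ b - φ c))

/-- The part of the flux of `U` into `v` which is carried by the triangle `v y z`; up to sign it is
the derivative of the angle at `v` in the direction `U`. -/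
def flux (κ : ℤ × ℤ → ℤ × ℤ → ℤ × ℤ → ℝ) (U : ℤ × ℤ → ℝ) (v y z : ℤ × ℤ) : ℝ :=
  κ z v y * (U y - U v) + κ y v z * (U z - U v)

/-- `U` is the potential of a flow of total strength `m` from the apex `(0, 0)` to the opposite
side, in weak form. -/
structure IsFlow (n : ℕ) (κ : ℤ × ℤ → ℤ × ℤ → ℤ × ℤ → ℝ) (U : ℤ × ℤ → ℝ) (m : ℝ) : Prop where
  comm : ∀ a b c, κ a b c = κ a c b
  weight_nonneg : ∀ a b c, (a, b, c) ∈ tris n → 0 ≤ κ a b c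
  weight_pos : ∀ a b c, (a, b, c) ∈ tris n → 0 < κ b a c ∧ 0 < κ c a b
  boundary : ∀ v : ℤ × ℤ, v.1 + v.2 = n → U v = 0
  strength : 0 ≤ m
  weak : ∀ φ : ℤ × ℤ → ℝ, (∀ v : ℤ × ℤ, v.1 + v.2 = n → φ v = 0) →
    ∑ t ∈ tris n, energy κ U φ t.1 t.2.1 t.2.2 = m * φ (0, 0)
  weight_swap : ∀ a b c : ℤ × ℤ, κ a.swap b.swap c.swap = κ a b c
  potential_swap : ∀ v : ℤ × ℤ, U v.swap = U v

lemma near_of_mem_tris {n : ℕ} {a b c : ℤ × ℤ} (h : (a, b, c) ∈ tris n) :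
    (|a.1 - b.1| ≤ 1 ∧ |a.2 - b.2| ≤ 1) ∧ (|a.1 - c.1| ≤ 1 ∧ |a.2 - c.2| ≤ 1) ∧
      (|b.1 - c.1| ≤ 1 ∧ |b.2 - c.2| ≤ 1) := by
  rcases mem_tris.1 h with ⟨-, rfl, rfl⟩ | ⟨-, rfl, rfl⟩ <;>
    simp

variable {n : ℕ} {κ : ℤ × ℤ → ℤ × ℤ → ℤ × ℤ → ℝ} {U φ : ℤ × ℤ → ℝ} {m : ℝ}

lemma mul_sub_nonneg_of_monotone {g : ℝ → ℝ} (hg : Monotone g) (x y : ℝ) :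
    0 ≤ (x - y) * (g x - g y) := by
  rcases le_total x y with h | h
  · exact mul_nonneg_of_nonpos_of_nonpos (sub_nonpos.2 h) (sub_nonpos.2 (hg h))
  · exact mul_nonneg (sub_nonneg.2 h) (sub_nonneg.2 (hg h))

lemma monotone_ite_lt (s : ℝ) : Monotone fun x : ℝ => if s < x then (1 : ℝ) else 0 := by
  intro x y hxy
  dsimp only
  split_ifs with h1 h2
  · exact le_rfl
  · exact absurd (h1.trans_le hxy) h2
  · exact zero_le_one
  · exact le_rfl

lemma monotone_ite_le (s : ℝ) : Monotone fun x : ℝ => if s ≤ x then (1 : ℝ) else 0 := by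
  intro x y hxy
  dsimp only
  split_ifs with h1 h2
  · exact le_rfl
  · exact absurd (h1.trans hxy) h2
  · exact zero_le_one
  · exact le_rfl

lemma CornerOf.inV {v y z : ℤ × ℤ} (hc : CornerOf n v y z) : inV n v ∧ inV n y ∧ inV n z := by
  rcases hc with h | h | h <;> have := inV_of_mem_tris h <;> tauto

namespace IsFlow

lemma weights_nonneg (h : IsFlow n κ U m) {a b c : ℤ × ℤ} (ht : (a, b, c) ∈ tris n) :
    0 ≤ κ a b c ∧ 0 ≤ κ b a c ∧ 0 ≤ κ c a b :=
  ⟨h.weight_nonneg _ _ _ ht, (h.weight_pos _ _ _ ht).1.le, (h.weight_pos _ _ _ ht).2.le⟩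

lemma energy_nonneg (h : IsFlow n κ U m)
    (hmono : ∀ x y, inV n x → inV n y → |x.1 - y.1| ≤ 1 → |x.2 - y.2| ≤ 1 →
      0 ≤ (U x - U y) * (φ x - φ y)) {a b c : ℤ × ℤ} (ht : (a, b, c) ∈ tris n) :
    0 ≤ energy κ U φ a b c := by
  obtain ⟨h1, h2, h3⟩ := h.weights_nonneg ht
  obtain ⟨va, vb, vc⟩ := inV_of_mem_tris ht
  obtain ⟨n1, n2, n3⟩ := near_of_mem_tris ht
  have e1 := mul_nonneg h3 (hmono a b va vb n1.1 n1.2)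
  have e2 := mul_nonneg h2 (hmono a c va vc n2.1 n2.2)
  have e3 := mul_nonneg h1 (hmono b c vb vc n3.1 n3.2)
  unfold energy; linarith

lemma sum_energy_le (h : IsFlow n κ U m) (hφ : ∀ v : ℤ × ℤ, v.1 + v.2 = n → φ v = 0)
    (hmono : ∀ x y, inV n x → inV n y → |x.1 - y.1| ≤ 1 → |x.2 - y.2| ≤ 1 →
      0 ≤ (U x - U y) * (φ x - φ y))
    {S : Finset ((ℤ × ℤ) × (ℤ × ℤ) × (ℤ × ℤ))} (hS : S ⊆ tris n) :
    ∑ t ∈ S, energy κ U φ t.1 t.2.1 t.2.2 ≤ m * φ (0, 0) := by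
  rw [← h.weak φ hφ]
  exact Finset.sum_le_sum_of_subset_of_nonneg hS fun t ht _ => h.energy_nonneg hmono ht

/-- Uniqueness principle: a test function with vanishing energy against `U` is zero. -/
lemma eq_zero (h : IsFlow n κ U m) (hφ : ∀ v : ℤ × ℤ, v.1 + v.2 = n → φ v = 0)
    (hA : m * φ (0, 0) ≤ 0)
    (hmono : ∀ x y, inV n x → inV n y → |x.1 - y.1| ≤ 1 → |x.2 - y.2| ≤ 1 →
      0 ≤ (U x - U y) * (φ x - φ y) ∧ ((U x - U y) * (φ x - φ y) = 0 → φ x = φ y))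
    {v : ℤ × ℤ} (hv : inV n v) : φ v = 0 := by
  have hm' := fun x y hx hy h1 h2 => (hmono x y hx hy h1 h2).1
  have hz := (Finset.sum_eq_zero_iff_of_nonneg fun t ht => h.energy_nonneg hm' ht).1
    (le_antisymm ((h.weak φ hφ).trans_le hA) (Finset.sum_nonneg fun t ht => h.energy_nonneg hm' ht))
  have hc : ∀ v, inV n v → φ v = φ (0, 0) := fun v hv => by
    refine eq_zero_of_edges (fun a b c ht => ?_) hv
    have hE := hz _ ht
    obtain ⟨h1, -, -⟩ := h.weights_nonneg ht
    obtain ⟨h2, h3⟩ := h.weight_pos _ _ _ ht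
    obtain ⟨va, vb, vc⟩ := inV_of_mem_tris ht
    obtain ⟨n1, n2, n3⟩ := near_of_mem_tris ht
    obtain ⟨m1, m1'⟩ := hmono a b va vb n1.1 n1.2
    obtain ⟨m2, m2'⟩ := hmono a c va vc n2.1 n2.2
    have e3 := mul_nonneg h1 (hm' b c vb vc n3.1 n3.2)
    have e1 := mul_nonneg h3.le m1
    have e2 := mul_nonneg h2.le m2
    simp only [energy] at hE
    refine ⟨m1' ?_, m2' ?_⟩
    · exact (mul_eq_zero.1 (show κ c a b * _ = 0 by linarith)).resolve_left h3.ne'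
    · exact (mul_eq_zero.1 (show κ b a c * _ = 0 by linarith)).resolve_left h2.ne'
  rw [hc v hv, ← hc (0, n) (by simp [inV]), hφ _ (by simp)]

lemma potential_nonneg (h : IsFlow n κ U m) {v : ℤ × ℤ} (hv : inV n v) : 0 ≤ U v := by
  have := h.eq_zero (φ := fun v => min (U v) 0) (fun v hv => by simp [h.boundary v hv])
    (mul_nonpos_of_nonneg_of_nonpos h.strength (min_le_right _ _)) ?_ hv
  · simpa using this
  · intro x y _ _ _ _
    rcases le_total (U x) 0 with hx | hx <;> rcases le_total (U y) 0 with hy | hy <;>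
      simp only [min_eq_left hx, min_eq_right hx, min_eq_left hy, min_eq_right hy]
    · exact ⟨mul_self_nonneg _, fun h => by nlinarith⟩
    · exact ⟨by nlinarith, fun h => by nlinarith⟩
    · exact ⟨by nlinarith, fun h => by nlinarith⟩
    · simp

lemma energy_comm (h : IsFlow n κ U m) (a b c : ℤ × ℤ) :
    energy κ U φ a b c = energy κ U φ b a c := by
  simp only [energy, h.comm c a b]; ring

lemma energy_rotate (h : IsFlow n κ U m) (a b c : ℤ × ℤ) :
    energy κ U φ a b c = energy κ U φ c a b := by
  simp only [energy, h.comm b a c, h.comm a b c]; ring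

lemma energy_swap (h : IsFlow n κ U m) (g : ℝ → ℝ) (a b c : ℤ × ℤ) :
    energy κ U (g ∘ U) a.swap c.swap b.swap = energy κ U (g ∘ U) a b c := by
  simp only [energy, h.weight_swap, h.potential_swap, Function.comp, h.comm a c b]; ring

/-- For monotone `g` with `g 0 = 0` and `g ≤ 1`, the energy of `g ∘ U` against `U` in any set of
triangles is at most the strength of the flow. -/
lemma sum_energy_comp_le (h : IsFlow n κ U m) {g : ℝ → ℝ} (hg : Monotone g) (hg0 : g 0 = 0)
    (hg1 : ∀ x, g x ≤ 1) {S : Finset ((ℤ × ℤ) × (ℤ × ℤ) × (ℤ × ℤ))} (hS : S ⊆ tris n) :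
    ∑ t ∈ S, energy κ U (g ∘ U) t.1 t.2.1 t.2.2 ≤ m :=
  (h.sum_energy_le (fun v hv => by simp [h.boundary v hv, hg0])
    (fun x y _ _ _ _ => mul_sub_nonneg_of_monotone hg _ _) hS).trans
    (mul_le_of_le_one_right h.strength (hg1 _))

lemma weights_nonneg_of_cornerOf (h : IsFlow n κ U m) {v y z : ℤ × ℤ} (hc : CornerOf n v y z) :
    0 ≤ κ v y z ∧ 0 ≤ κ y v z ∧ 0 ≤ κ z v y := by
  rcases hc with ht | ht | ht <;> obtain ⟨h1, h2, h3⟩ := h.weights_nonneg ht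
  · exact ⟨h1, h2, h3⟩
  · exact ⟨h2, h1, by rwa [h.comm]⟩
  · exact ⟨h3, by rwa [h.comm], by rwa [h.comm]⟩

/-- The flux through a corner is dominated by the energy of a suitable level cut. -/
lemma exists_cut_flux (h : IsFlow n κ U m) {v y z : ℤ × ℤ} (hc : CornerOf n v y z) :
    ∃ g : ℝ → ℝ, Monotone g ∧ g 0 = 0 ∧ (∀ x, g x ≤ 1) ∧
      |flux κ U v y z| ≤ energy κ U (g ∘ U) v y z := by
  obtain ⟨h1, h2, h3⟩ := h.weights_nonneg_of_cornerOf hc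
  obtain ⟨hv, hy, hz⟩ := hc.inV
  replace hv := h.potential_nonneg hv
  replace hy := h.potential_nonneg hy
  replace hz := h.potential_nonneg hz
  rcases le_or_gt 0 (flux κ U v y z) with hf | hf
  · refine ⟨_, monotone_ite_lt (U v), by simp [hv], fun x => ?_, ?_⟩
    · split_ifs <;> norm_num
    · rw [abs_of_nonneg hf]
      have e1 := mul_nonneg h1 (mul_sub_nonneg_of_monotone (monotone_ite_lt (U v)) (U y) (U z))
      simp only [energy, flux, Function.comp, lt_irrefl, if_false] at e1 ⊢
      refine le_trans (add_le_add (mul_le_mul_of_nonneg_left ?_ h3)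
        (mul_le_mul_of_nonneg_left ?_ h2)) (le_add_of_nonneg_right e1)
      · split_ifs <;> linarith
      · split_ifs <;> linarith
  · have hp : 0 < U v := by
      by_contra hv'
      have : U v = 0 := le_antisymm (not_lt.1 hv') hv
      simp only [flux, this, sub_zero] at hf
      linarith [mul_nonneg h3 hy, mul_nonneg h2 hz]
    refine ⟨_, monotone_ite_le (U v), by simp [hp], fun x => ?_, ?_⟩
    · split_ifs <;> norm_num
    · rw [abs_of_neg hf]
      have e1 := mul_nonneg h1 (mul_sub_nonneg_of_monotone (monotone_ite_le (U v)) (U y) (U z))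
      simp only [energy, flux, Function.comp, le_refl, if_true, neg_add, ← mul_neg] at e1 ⊢
      refine le_trans (add_le_add (mul_le_mul_of_nonneg_left ?_ h3)
        (mul_le_mul_of_nonneg_left ?_ h2)) (le_add_of_nonneg_right e1)
      · split_ifs <;> linarith
      · split_ifs <;> linarith

lemma exists_cut_edge (h : IsFlow n κ U m) {x y : ℤ × ℤ} (hx : inV n x) (hy : inV n y) :
    ∃ g : ℝ → ℝ, Monotone g ∧ g 0 = 0 ∧ (∀ x, g x ≤ 1) ∧
      |U x - U y| ≤ (U x - U y) * (g (U x) - g (U y)) := by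
  replace hx := h.potential_nonneg hx
  replace hy := h.potential_nonneg hy
  refine ⟨_, monotone_ite_lt (min (U x) (U y)), by simp [hx, hy], fun x => ?_, ?_⟩
  · split_ifs <;> norm_num
  · rcases lt_trichotomy (U x) (U y) with hxy | hxy | hxy
    · rw [min_eq_left hxy.le, abs_of_neg (sub_neg.2 hxy)]; simp [hxy]
    · simp [hxy]
    · rw [min_eq_right hxy.le, abs_of_pos (sub_pos.2 hxy)]; simp [hxy]

/-- The angles move at most as fast as the angle sum at the apex. -/
lemma abs_flux_le (h : IsFlow n κ U m) {v y z : ℤ × ℤ} (hc : CornerOf n v y z) :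
    |flux κ U v y z| ≤ m := by
  obtain ⟨g, hg, hg0, hg1, hle⟩ := h.exists_cut_flux hc
  refine hle.trans ?_
  rcases hc with ht | ht | ht
  · simpa using h.sum_energy_comp_le hg hg0 hg1 (Finset.singleton_subset_iff.2 ht)
  · rw [h.energy_comm]
    simpa using h.sum_energy_comp_le hg hg0 hg1 (Finset.singleton_subset_iff.2 ht)
  · rw [h.energy_rotate, h.energy_rotate]
    simpa using h.sum_energy_comp_le hg hg0 hg1 (Finset.singleton_subset_iff.2 ht)

lemma two_mul_energy_comp_le (h : IsFlow n κ U m) {g : ℝ → ℝ} (hg : Monotone g) (hg0 : g 0 = 0)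
    (hg1 : ∀ x, g x ≤ 1) {a b c : ℤ × ℤ} (ht : (a, b, c) ∈ tris n) (ha : a ≠ a.swap) :
    2 * energy κ U (g ∘ U) a b c ≤ m := by
  have := h.sum_energy_comp_le hg hg0 hg1 (S := {(a, b, c), (a.swap, c.swap, b.swap)}) (by
    intro t
    simp only [Finset.mem_insert, Finset.mem_singleton]
    rintro (rfl | rfl)
    exacts [ht, swap_mem_tris ht])
  rwa [Finset.sum_pair (by simp [ha]), h.energy_swap, ← two_mul] at this

lemma swap_of_mem_tris {a b c : ℤ × ℤ} (ht : (a, b, c) ∈ tris n) (ha : a.swap = a) :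
    c = b.swap := by
  obtain ⟨a₁, a₂⟩ := a
  rcases mem_tris.1 ht with ⟨-, rfl, rfl⟩ | ⟨-, rfl, rfl⟩ <;>
    simp only [Prod.swap, Prod.mk.injEq, Prod.mk_add_mk, Prod.mk_sub_mk] at * <;> omega

/-- In a triangle on the symmetry axis the two weights at the base are equal, as are the
potentials. -/
lemma symm_of_mem_tris (h : IsFlow n κ U m) {a b c : ℤ × ℤ} (ht : (a, b, c) ∈ tris n)
    (ha : a.swap = a) : U c = U b ∧ κ b a c = κ c a b := by
  obtain rfl := swap_of_mem_tris ht ha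
  refine ⟨h.potential_swap b, ?_⟩
  rw [← h.weight_swap b a, ha, Prod.swap_swap]

lemma two_mul_abs_edge_le (h : IsFlow n κ U m) {a b c : ℤ × ℤ} (ht : (a, b, c) ∈ tris n)
    (ha : a.swap = a) : 2 * (κ c a b * |U b - U a|) ≤ m := by
  obtain ⟨va, vb, vc⟩ := inV_of_mem_tris ht
  obtain ⟨g, hg, hg0, hg1, hle⟩ := h.exists_cut_edge va vb
  obtain ⟨h1, h2⟩ := h.symm_of_mem_tris ht ha
  have := h.sum_energy_comp_le hg hg0 hg1 (Finset.singleton_subset_iff.2 ht)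
  simp only [Finset.sum_singleton, energy, Function.comp, h1, h2] at this
  have := mul_le_mul_of_nonneg_left hle (h.weights_nonneg ht).2.2
  rw [abs_sub_comm] at this
  linarith

/-- By symmetry, a corner which is not on the symmetry axis moves at most half as fast as the
angle sum at the apex. -/
lemma two_mul_abs_flux_le (h : IsFlow n κ U m) {v y z : ℤ × ℤ} (hc : CornerOf n v y z)
    (hv : v.swap ≠ v ∨ (v, y, z) ∉ tris n) : 2 * |flux κ U v y z| ≤ m := by
  obtain ⟨g, hg, hg0, hg1, hle⟩ := h.exists_cut_flux hc
  rcases hc with ht | ht | ht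
  · have ha : v.swap ≠ v := by tauto
    linarith [h.two_mul_energy_comp_le hg hg0 hg1 ht ha.symm]
  · by_cases ha : y.swap = y
    · obtain ⟨h1, h2⟩ := h.symm_of_mem_tris ht ha
      have := h.two_mul_abs_edge_le ht ha
      rwa [flux, h1, sub_self, mul_zero, add_zero, abs_mul, h.comm z,
        abs_of_nonneg (h.weights_nonneg ht).2.2, abs_sub_comm]
    · rw [h.energy_comm] at hle
      linarith [h.two_mul_energy_comp_le hg hg0 hg1 ht (Ne.symm ha)]
  · by_cases ha : y.swap = y
    · obtain ⟨h1, h2⟩ := h.symm_of_mem_tris ht ha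
      have := h.two_mul_abs_edge_le ht ha
      rwa [flux, h1, sub_self, mul_zero, add_zero, abs_mul, h.comm z, h2,
        abs_of_nonneg (h.weights_nonneg ht).2.2, abs_sub_comm]
    · rw [h.energy_rotate, h.energy_rotate] at hle
      linarith [h.two_mul_energy_comp_le hg hg0 hg1 ht (Ne.symm ha)]

/-- Under bounds for the weights of the other corners, a corner on the symmetry axis which is not
at the apex moves at most `4 / 5` times as fast as the angle sum at the apex. -/
lemma five_mul_abs_flux_le (h : IsFlow n κ U m)
    (hκ : ∀ v y z, CornerOf n v y z → (v.swap ≠ v ∨ (v, y, z) ∉ tris n) →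
      1 / 4 ≤ κ v y z ∧ κ v y z ≤ 1)
    {a b c : ℤ × ℤ} (ht : (a, b, c) ∈ tris n) (ha : a.swap = a) (ha0 : a ≠ (0, 0)) :
    5 * |flux κ U a b c| ≤ 4 * m := by
  obtain ⟨va, vb, vc⟩ := inV_of_mem_tris ht
  obtain ⟨h1, h2⟩ := h.symm_of_mem_tris ht ha
  obtain ⟨d, hd, hds⟩ : ∃ d, (c, a, d) ∈ tris n ∧ d.swap ≠ d := by
    refine ⟨a + (-1, 1), ?_, ?_⟩
    · rw [mem_tris]
      simp only [inV, ne_eq, Prod.ext_iff, Prod.swap] at va ha ha0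
      rcases mem_tris.1 ht with ⟨hv, rfl, rfl⟩ | ⟨hv, rfl, rfl⟩
      · right
        simp only [validDown, validUp, Prod.ext_iff, Prod.fst_add, Prod.snd_add, Prod.fst_sub,
          Prod.snd_sub] at *
        omega
      · left
        simp only [validDown, validUp, Prod.ext_iff, Prod.fst_add, Prod.snd_add, Prod.fst_sub,
          Prod.snd_sub] at *
        omega
    · simp only [ne_eq, Prod.ext_iff, Prod.swap, Prod.fst_add, Prod.snd_add] at ha ⊢
      omega
  have hcs : c.swap ≠ c ∧ a ≠ c ∧ a ≠ b ∧ c ≠ b := by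
    rcases mem_tris.1 ht with ⟨hv, rfl, rfl⟩ | ⟨hv, rfl, rfl⟩ <;>
      simp only [ne_eq, Prod.ext_iff, Prod.swap, Prod.fst_add, Prod.snd_add, Prod.fst_sub,
          Prod.snd_sub] at ha ⊢ <;> omega
  have hcb := swap_of_mem_tris ht ha
  obtain ⟨g, hg, hg0, hg1, hle⟩ := h.exists_cut_edge va vb
  have hS := h.sum_energy_comp_le hg hg0 hg1
    (S := {(a, b, c), (c, a, d), (c.swap, d.swap, a.swap)}) (by
      intro t
      simp only [Finset.mem_insert, Finset.mem_singleton]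
      rintro (rfl | rfl | rfl)
      exacts [ht, hd, swap_mem_tris hd])
  rw [Finset.sum_insert, Finset.sum_pair] at hS
  · rw [h.energy_swap] at hS
    have hc := (hκ c a b (Or.inr (Or.inr ht)) (Or.inl hcs.1)).2
    have hd4 := (hκ d c a (Or.inr (Or.inr hd)) (Or.inl hds)).1
    obtain ⟨k1, k2, k3⟩ := h.weights_nonneg hd
    have e1 := mul_nonneg k2 (mul_sub_nonneg_of_monotone hg (U c) (U d))
    have e2 := mul_nonneg k1 (mul_sub_nonneg_of_monotone hg (U a) (U d))
    have e3 := mul_le_mul_of_nonneg_left hle (h.weights_nonneg ht).2.2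
    have e4 := mul_le_mul hd4 hle (abs_nonneg _) k3
    have e5 := mul_le_mul_of_nonneg_right hc (abs_nonneg (U a - U b))
    have e6 : |flux κ U a b c| = 2 * (κ c a b * |U a - U b|) := by
      rw [flux, h1, h2, ← two_mul, abs_mul, abs_mul, abs_sub_comm (U b),
        abs_of_nonneg (h.weights_nonneg ht).2.2, abs_two]
    simp only [energy, Function.comp, h1, h2] at hS e1 e2
    rw [e6]
    linarith
  · simp only [ne_eq, Prod.mk.injEq, not_and]
    exact fun hc => absurd hc.symm hcs.1
  · simp only [Finset.mem_insert, Finset.mem_singleton, Prod.mk.injEq]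
    rw [hcb, Prod.swap_swap]
    have := hcs.2.1
    rw [hcb] at this
    tauto

lemma flux_nonneg (h : IsFlow n κ U m) {v y z : ℤ × ℤ} (hc : CornerOf n v y z)
    (hv : v.1 + v.2 = n) : 0 ≤ flux κ U v y z := by
  obtain ⟨h1, h2, h3⟩ := h.weights_nonneg_of_cornerOf hc
  obtain ⟨-, hy, hz⟩ := hc.inV
  rw [flux, h.boundary v hv, sub_zero, sub_zero]
  exact add_nonneg (mul_nonneg h3 (h.potential_nonneg hy)) (mul_nonneg h2 (h.potential_nonneg hz))

end IsFlow

end Flow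

section Shell

variable {n : ℕ} {κ : ℤ × ℤ → ℤ × ℤ → ℤ × ℤ → ℝ} {U : ℤ × ℤ → ℝ} {m : ℝ}

lemma sq_sub_le_mul_sum_sq (g : ℕ → ℝ) (L : ℕ) :
    (g L - g 0) ^ 2 ≤ L * ∑ k ∈ Finset.range L, (g (k + 1) - g k) ^ 2 := by
  have := sq_sum_le_card_mul_sum_sq (s := Finset.range L) (f := fun k => g (k + 1) - g k)
  rwa [Finset.sum_range_sub, Finset.card_range] at this

lemma sum_sum_fiber_le {ι : Type*} {D : Finset ι} {H : ι → ℝ} (hH : ∀ p ∈ D, 0 ≤ H p)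
    (x : ι → ℤ) (i : ℤ) (R : ℕ) :
    ∑ k ∈ Finset.range R, ∑ p ∈ D with x p = i - (k + 1), H p ≤ ∑ p ∈ D, H p := by
  simp only [Finset.sum_filter]
  rw [Finset.sum_comm]
  refine Finset.sum_le_sum fun p hp => ?_
  rw [← Finset.sum_filter, Finset.sum_const, nsmul_eq_mul]
  refine mul_le_of_le_one_left (hH p hp) ?_
  have : ((Finset.range R).filter fun k : ℕ => x p = i - (k + 1)).card ≤ 1 := by
    rw [Finset.card_le_one]
    intro a ha b hb
    simp only [Finset.mem_filter] at ha hb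
    omega
  exact_mod_cast this

/-- A path in direction `d` from `z` to the side opposite to the apex carries at least the energy
which is given by the Cauchy–Schwarz inequality. -/
lemma sq_le_mul_sum_of_path {f : ℤ × ℤ → ℝ} (hf : ∀ v : ℤ × ℤ, v.1 + v.2 = n → f v = 0)
    {d : ℤ × ℤ} (hd : d = (1, 0) ∨ d = (0, 1)) {z : ℤ × ℤ} (hz : inV n z)
    {S : Finset (ℤ × ℤ)} (hS : ∀ k : ℕ, z.1 + z.2 + k + 1 ≤ n → z + (k : ℤ) • d ∈ S) :
    f z ^ 2 ≤ (n - z.1 - z.2) * ∑ p ∈ S, (f p - f (p + d)) ^ 2 := by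
  obtain ⟨L, hL⟩ := Int.eq_ofNat_of_zero_le (show 0 ≤ n - z.1 - z.2 by have := hz.2.2; omega)
  have h := sq_sub_le_mul_sum_sq (fun k => f (z + (k : ℤ) • d)) L
  have hend : f (z + (L : ℤ) • d) = 0 := by
    apply hf
    rcases hd with rfl | rfl <;> simp <;> omega
  simp only [hend, Nat.cast_zero, zero_smul, add_zero, zero_sub, neg_sq] at h
  have hcast : ((n : ℝ) - z.1 - z.2) = L := by exact_mod_cast hL
  rw [hcast]
  refine h.trans (mul_le_mul_of_nonneg_left ?_ L.cast_nonneg)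
  have hinj : Set.InjOn (fun k : ℕ => z + (k : ℤ) • d) (Finset.range L) := by
    intro a _ b _ hab
    rcases hd with rfl | rfl <;> simpa using hab
  calc ∑ k ∈ Finset.range L, (f (z + ((k + 1 : ℕ) : ℤ) • d) - f (z + (k : ℤ) • d)) ^ 2
      = ∑ p ∈ (Finset.range L).image fun k : ℕ => z + (k : ℤ) • d, (f p - f (p + d)) ^ 2 := by
        rw [Finset.sum_image hinj]
        refine Finset.sum_congr rfl fun k _ => ?_
        rw [Nat.cast_succ, add_smul, one_smul, ← add_assoc]
        ring
    _ ≤ _ := by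
        refine Finset.sum_le_sum_of_subset_of_nonneg ?_ fun _ _ _ => sq_nonneg _
        intro p hp
        obtain ⟨k, hk, rfl⟩ := Finset.mem_image.1 hp
        rw [Finset.mem_range] at hk
        exact hS k (by omega)

namespace IsFlow

/-- The box of radius `r` around `v` has a boundary point where the potential is as high as at the
neighbour `y` of `v`. -/
lemma exists_le_potential (h : IsFlow n κ U m) {v y : ℤ × ℤ} (hy : inV n y)
    (h1 : |y.1 - v.1| ≤ 1) (h2 : |y.2 - v.2| ≤ 1) (hs : 0 < U y) {r : ℤ} (hr : 1 ≤ r)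
    (hrv : r < v.1) : ∃ z, inV n z ∧ U y ≤ U z ∧
      ((z.1 = v.1 - r ∧ v.2 - r ≤ z.2) ∨ (z.2 = v.2 - r ∧ v.1 - r ≤ z.1)) := by
  by_contra! hz
  let φ : ℤ × ℤ → ℝ := fun x => if (v.1 - r ≤ x.1 ∧ v.2 - r ≤ x.2) ∧ U y ≤ U x then 1 else 0
  have hy1 : φ y = 1 := by
    rw [abs_le] at h1 h2
    exact if_pos ⟨⟨by omega, by omega⟩, le_rfl⟩
  have key : ∀ x x' : ℤ × ℤ, inV n x → |x.1 - x'.1| ≤ 1 → |x.2 - x'.2| ≤ 1 → φ x = 1 →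
      φ x' = 0 → 0 < U x - U x' := by
    intro x x' hx n1 n2 hφ hφ'
    have hx1 : (v.1 - r ≤ x.1 ∧ v.2 - r ≤ x.2) ∧ U y ≤ U x := by
      by_contra hn
      exact zero_ne_one ((show φ x = 0 from if_neg hn).symm.trans hφ)
    have hx2 : ¬ ((v.1 - r ≤ x'.1 ∧ v.2 - r ≤ x'.2) ∧ U y ≤ U x') := by
      intro hn
      exact one_ne_zero ((show φ x' = 1 from if_pos hn).symm.trans hφ')
    have hb := hz x hx hx1.2
    have : v.1 - r ≤ x'.1 ∧ v.2 - r ≤ x'.2 := by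
      rw [abs_le] at n1 n2
      omega
    have : ¬ U y ≤ U x' := fun hn => hx2 ⟨this, hn⟩
    linarith [hx1.2]
  have hval : ∀ x, φ x = 0 ∨ φ x = 1 := fun x => by
    simp only [φ]; split_ifs <;> simp
  have := h.eq_zero (φ := φ) (fun x hx => if_neg fun hn => by
      rw [h.boundary x hx] at hn; linarith [hn.2])
    (by
      have : φ (0, 0) = 0 := if_neg (by rintro ⟨⟨h, -⟩, -⟩; simp only at h; omega)
      simp [this])
    (fun x x' hx hx' n1 n2 => by
      rcases hval x with e | e <;> rcases hval x' with e' | e'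
      · simp [e, e']
      · have := key x' x hx' (by rwa [abs_sub_comm]) (by rwa [abs_sub_comm]) e' e
        rw [e, e']
        exact ⟨by linarith, fun h => by linarith⟩
      · have := key x x' hx n1 n2 e e'
        rw [e, e']
        exact ⟨by linarith, fun h => by linarith⟩
      · simp [e, e']) hy
  rw [hy1] at this
  exact one_ne_zero this

/-- The Dirichlet energy of the potential truncated at height `s`. -/
lemma sum_sq_truncation_le (h : IsFlow n κ U m) {c s : ℝ} (hs : 0 ≤ s)
    (hc : ∀ x y z, (x, y, z) ∈ tris n → c ≤ κ y x z ∧ c ≤ κ z x y) :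
    c * ∑ p ∈ (verts n).filter (validDown n),
      ((min (U p) s - min (U (p + (1, 0))) s) ^ 2 + (min (U p) s - min (U (p + (0, 1))) s) ^ 2) ≤
      m * s := by
  have hmono : ∀ x y, (min x s - min y s) ^ 2 ≤ (x - y) * (min x s - min y s) := by
    intro x y
    rcases le_total x s with hx | hx <;> rcases le_total y s with hy | hy <;>
      simp only [min_eq_left, min_eq_right, hx, hy] <;> nlinarith
  refine le_trans ?_ ((h.sum_energy_le (φ := fun v => min (U v) s)
    (S := ((verts n).filter (validDown n)).image fun p => (p, p + (1, 0), p + (0, 1)))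
    (fun v hv => by simp [h.boundary v hv, hs])
    (fun x y _ _ _ _ => (sq_nonneg _).trans (hmono _ _)) Finset.subset_union_left).trans
    (mul_le_mul_of_nonneg_left (min_le_right _ _) h.strength))
  rw [Finset.sum_image (fun p _ q _ hpq => congrArg Prod.fst hpq), Finset.mul_sum]
  refine Finset.sum_le_sum fun p hp => ?_
  have ht := down_mem_tris (Finset.mem_filter.1 hp).2
  obtain ⟨c1, c2⟩ := hc _ _ _ ht
  obtain ⟨k1, k2, k3⟩ := h.weights_nonneg ht
  have e1 := mul_le_mul_of_nonneg_right c2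
    (sq_nonneg (min (U p) s - min (U (p + (1, 0))) s))
  have e2 := mul_le_mul_of_nonneg_right c1
    (sq_nonneg (min (U p) s - min (U (p + (0, 1))) s))
  have e3 := mul_le_mul_of_nonneg_left (hmono (U p) (U (p + (1, 0)))) k3
  have e4 := mul_le_mul_of_nonneg_left (hmono (U p) (U (p + (0, 1)))) k2
  have e5 := mul_nonneg k1 ((sq_nonneg _).trans (hmono (U (p + (1, 0))) (U (p + (0, 1)))))
  unfold energy
  linarith

lemma mul_log_fst_le (h : IsFlow n κ U m) {c : ℝ} (hc0 : 0 ≤ c)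
    (hc : ∀ x y z, (x, y, z) ∈ tris n → c ≤ κ y x z ∧ c ≤ κ z x y)
    {v y : ℤ × ℤ} (hv : v.1 + v.2 = n) (hv1 : 1 ≤ v.1) (hy : inV n y)
    (h1 : |y.1 - v.1| ≤ 1) (h2 : |y.2 - v.2| ≤ 1) :
    c * U y * Real.log v.1 ≤ 2 * m := by
  rcases (h.potential_nonneg hy).eq_or_lt with hs | hs
  · rw [← hs]; simpa using h.strength
  obtain ⟨R, hR⟩ := Int.eq_ofNat_of_zero_le (show 0 ≤ v.1 - 1 by omega)
  set D := (verts n).filter (validDown n)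
  set s := U y
  let f : ℤ × ℤ → ℝ := fun p => min (U p) s
  have hf : ∀ v : ℤ × ℤ, v.1 + v.2 = n → f v = 0 := fun v hv => by
    simp [f, h.boundary v hv, hs.le]
  have hE := h.sum_sq_truncation_le hs.le hc
  rw [Finset.sum_add_distrib] at hE
  have hcol := sum_sum_fiber_le (D := D) (H := fun p => (f p - f (p + (0, 1))) ^ 2)
    (fun _ _ => sq_nonneg _) (fun p => p.1) v.1 R
  have hrow := sum_sum_fiber_le (D := D) (H := fun p => (f p - f (p + (1, 0))) ^ 2)
    (fun _ _ => sq_nonneg _) (fun p => p.2) v.2 R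
  have hr : ∀ k ∈ Finset.range R, s ^ 2 / 2 * ((k + 1 : ℕ) : ℝ)⁻¹ ≤
      ∑ p ∈ D with p.1 = v.1 - (k + 1), (f p - f (p + (0, 1))) ^ 2 +
      ∑ p ∈ D with p.2 = v.2 - (k + 1), (f p - f (p + (1, 0))) ^ 2 := by
    intro k hk
    rw [Finset.mem_range] at hk
    have hpos : (0 : ℝ) < (k + 1 : ℕ) := by positivity
    obtain ⟨z, hz, hUz, hzr⟩ := h.exists_le_potential hy h1 h2 hs (r := k + 1) (by omega) (by omega)
    have hfz : f z = s := min_eq_right hUz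
    have hn : ∀ S : ℝ, 0 ≤ S → f z ^ 2 ≤ (n - z.1 - z.2) * S →
        s ^ 2 / 2 * ((k + 1 : ℕ) : ℝ)⁻¹ ≤ S := by
      intro S hS hle
      have : ((n : ℝ) - z.1 - z.2) ≤ 2 * (k + 1 : ℕ) := by
        have : (n : ℤ) - z.1 - z.2 ≤ 2 * (k + 1 : ℕ) := by push_cast; omega
        exact_mod_cast this
      rw [← div_eq_mul_inv, div_le_iff₀ hpos, ← hfz]
      linarith [mul_le_mul_of_nonneg_right this hS]
    rcases hzr with ⟨hz1, hz2⟩ | ⟨hz1, hz2⟩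
    · refine le_add_of_le_of_nonneg (hn _ (Finset.sum_nonneg fun _ _ => sq_nonneg _)
        (sq_le_mul_sum_of_path hf (Or.inr rfl) hz fun i hi => ?_))
        (Finset.sum_nonneg fun _ _ => sq_nonneg _)
      have : validDown n (z + (i : ℤ) • (0, 1)) := by
        simp only [inV, validDown, Prod.fst_add, Prod.snd_add, Prod.smul_mk, smul_eq_mul] at *
        omega
      exact Finset.mem_filter.2 ⟨Finset.mem_filter.2 ⟨mem_verts_of_validDown this, this⟩,
        by simp [hz1]⟩
    · refine le_add_of_nonneg_of_le (Finset.sum_nonneg fun _ _ => sq_nonneg _)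
        (hn _ (Finset.sum_nonneg fun _ _ => sq_nonneg _)
        (sq_le_mul_sum_of_path hf (Or.inl rfl) hz fun i hi => ?_))
      have : validDown n (z + (i : ℤ) • (1, 0)) := by
        simp only [inV, validDown, Prod.fst_add, Prod.snd_add, Prod.smul_mk, smul_eq_mul] at *
        omega
      exact Finset.mem_filter.2 ⟨Finset.mem_filter.2 ⟨mem_verts_of_validDown this, this⟩,
        by simp [hz1]⟩
  have hsum := Finset.sum_le_sum hr
  rw [Finset.sum_add_distrib, ← Finset.mul_sum] at hsum
  have hlog : Real.log v.1 ≤ ∑ k ∈ Finset.range R, ((k + 1 : ℕ) : ℝ)⁻¹ := by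
    have := log_add_one_le_harmonic R
    rw [harmonic] at this
    push_cast at this ⊢
    rwa [show (v.1 : ℝ) = R + 1 by exact_mod_cast (by omega : v.1 = R + 1)]
  have h3 : s ^ 2 / 2 * Real.log v.1 ≤ s ^ 2 / 2 * ∑ k ∈ Finset.range R, ((k + 1 : ℕ) : ℝ)⁻¹ :=
    mul_le_mul_of_nonneg_left hlog (by positivity)
  have h4 := (mul_le_mul_of_nonneg_left ((h3.trans hsum).trans (add_le_add hcol hrow)) hc0)
  have h5 : s * (c * s * Real.log v.1) ≤ s * (2 * m) := by
    simp only [f] at h4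
    linarith
  exact le_of_mul_le_mul_left h5 hs

/-- The potential is of order `1 / log n` next to the side opposite to the apex. -/
lemma mul_log_le (h : IsFlow n κ U m) (hn : 1 ≤ n) {c : ℝ} (hc0 : 0 ≤ c)
    (hc : ∀ x y z, (x, y, z) ∈ tris n → c ≤ κ y x z ∧ c ≤ κ z x y)
    {v y : ℤ × ℤ} (hv : v.1 + v.2 = n) (hy : inV n y)
    (h1 : |y.1 - v.1| ≤ 1) (h2 : |y.2 - v.2| ≤ 1) :
    c * U y * Real.log (n / 2) ≤ 2 * m := by
  have hn0 : (0 : ℝ) < n := by exact_mod_cast hn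
  have hcU := mul_nonneg hc0 (h.potential_nonneg hy)
  rcases le_total v.2 v.1 with hle | hle
  · refine le_trans (mul_le_mul_of_nonneg_left (Real.log_le_log (by positivity) ?_) hcU)
      (h.mul_log_fst_le hc0 hc hv (by omega) hy h1 h2)
    rw [div_le_iff₀ two_pos]
    exact_mod_cast (by omega : (n : ℤ) ≤ v.1 * 2)
  · rw [← h.potential_swap] at hcU ⊢
    refine le_trans (mul_le_mul_of_nonneg_left (Real.log_le_log (by positivity) ?_) hcU)
      (h.mul_log_fst_le (v := v.swap) hc0 hc (by simp; omega) (by simp; omega)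
        (by simp only [inV, Prod.swap] at *; omega) h2 h1)
    rw [div_le_iff₀ two_pos]
    simp only [Prod.swap]
    exact_mod_cast (by omega : (n : ℤ) ≤ v.2 * 2)

end IsFlow

end Shell

section Angle

/-- The cosine, as given by the law of cosines, of the angle at `a` of a vertex-scaled equilateral
triangle. -/
noncomputable def cosAng (w : ℤ × ℤ → ℝ) (a b c : ℤ × ℤ) : ℝ :=
  (exp (w b - w c) + exp (w c - w b) - exp (w b + w c - 2 * w a)) / 2

/-- The angle at `a` of a vertex-scaled equilateral triangle. -/
noncomputable def ang (w : ℤ × ℤ → ℝ) (a b c : ℤ × ℤ) : ℝ := arccos (cosAng w a b c)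

/-- The cotangent of the angle at `a` of a vertex-scaled equilateral triangle. -/
noncomputable def cotAng (w : ℤ × ℤ → ℝ) (a b c : ℤ × ℤ) : ℝ := cot (ang w a b c)

lemma cosAng_comm (w : ℤ × ℤ → ℝ) (a b c : ℤ × ℤ) : cosAng w a b c = cosAng w a c b := by
  rw [cosAng, cosAng, add_comm (w c), add_comm (exp _)]

lemma ang_comm (w : ℤ × ℤ → ℝ) (a b c : ℤ × ℤ) : ang w a b c = ang w a c b := by
  rw [ang, ang, cosAng_comm]

lemma cotAng_comm (w : ℤ × ℤ → ℝ) (a b c : ℤ × ℤ) : cotAng w a b c = cotAng w a c b := by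
  rw [cotAng, cotAng, ang_comm]

lemma ang_swap {w : ℤ × ℤ → ℝ} (hw : ∀ v, w v.swap = w v) (a b c : ℤ × ℤ) :
    ang w a.swap b.swap c.swap = ang w a b c := by
  simp only [ang, cosAng, hw]

lemma ang_zero (a b c : ℤ × ℤ) : ang 0 a b c = π / 3 := by
  rw [ang, ← arccos_cos (x := π / 3) (by positivity) (by linarith [pi_pos]), cos_pi_div_three]
  norm_num [cosAng]

lemma angAt_eq_ang {n : ℕ} (hn : n ≠ 0) (w : ℤ × ℤ → ℝ) : angAt n w = ang w := by
  funext a b c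
  rw [angAt, triAngle, ang, cosAng]
  congr 1
  have hn : (n : ℝ) ≠ 0 := by exact_mod_cast hn
  simp only [el, exp_add, exp_sub, two_mul]
  have := exp_ne_zero (w a)
  have := exp_ne_zero (w b)
  have := exp_ne_zero (w c)
  field_simp
  ring

lemma cosAng_mem {w : ℤ × ℤ → ℝ} {a b c : ℤ × ℤ} (h : ang w a b c ∈ Set.Ioo 0 π) :
    -1 < cosAng w a b c ∧ cosAng w a b c < 1 :=
  ⟨arccos_lt_pi.1 h.2, arccos_pos.1 h.1⟩

lemma one_sub_cosAng_sq (w : ℤ × ℤ → ℝ) (a b c : ℤ × ℤ) :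
    1 - cosAng w a b c ^ 2 = exp (w c - w a) ^ 2 * (1 - cosAng w c a b ^ 2) := by
  simp only [cosAng, exp_add, exp_sub, two_mul]
  have := exp_ne_zero (w a)
  have := exp_ne_zero (w b)
  have := exp_ne_zero (w c)
  field_simp
  ring

/-- The law of sines. -/
lemma sin_ang (w : ℤ × ℤ → ℝ) (a b c : ℤ × ℤ) :
    sin (ang w a b c) = exp (w c - w a) * sin (ang w c a b) := by
  rw [ang, ang, sin_arccos, sin_arccos, one_sub_cosAng_sq w a b c, sqrt_mul (sq_nonneg _),
    sqrt_sq (exp_pos _).le]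

lemma cotAng_mul_sin {w : ℤ × ℤ → ℝ} {a b c : ℤ × ℤ} (h : ang w a b c ∈ Set.Ioo 0 π) :
    cotAng w c a b * sin (ang w a b c) =
      (exp (w c - w b) + exp (w b + w c - 2 * w a) - exp (w b - w c)) / 2 := by
  have hs := sin_pos_of_pos_of_lt_pi h.1 h.2
  rw [sin_ang] at hs ⊢
  have hs' := pos_of_mul_pos_right hs (exp_pos _).le
  have hc : ang w c a b ∈ Set.Ioo 0 π := by
    refine ⟨(arccos_nonneg _).lt_of_ne fun h0 => ?_, (arccos_le_pi _).lt_of_ne fun h0 => ?_⟩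
    · rw [ang, ← h0, sin_zero] at hs'; exact hs'.false
    · rw [ang, h0, sin_pi] at hs'; exact hs'.false
  have hm := cosAng_mem hc
  have hcos : cos (ang w c a b) = cosAng w c a b := cos_arccos hm.1.le hm.2.le
  rw [cotAng, cot_eq_cos_div_sin, hcos, mul_left_comm, div_mul_cancel₀ _ hs'.ne']
  simp only [cosAng, exp_add, exp_sub, two_mul]
  have := exp_ne_zero (w a)
  have := exp_ne_zero (w b)
  have := exp_ne_zero (w c)
  field_simp

variable {E : Type*} [NormedAddCommGroup E] [NormedSpace ℝ E]

lemma contDiffAt_ang (L : ℤ × ℤ → E →L[ℝ] ℝ) {x : E} {a b c : ℤ × ℤ}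
    (h : ang (fun v => L v x) a b c ∈ Set.Ioo 0 π) :
    ContDiffAt ℝ 2 (fun y => ang (fun v => L v y) a b c) x := by
  have hm := cosAng_mem h
  refine (contDiffAt_arccos hm.1.ne' hm.2.ne).comp x ?_
  unfold cosAng
  fun_prop

/-- The derivative of an angle of a vertex-scaled triangle. -/
lemma fderiv_ang (L : ℤ × ℤ → E →L[ℝ] ℝ) {x : E} {a b c : ℤ × ℤ}
    (h : ang (fun v => L v x) a b c ∈ Set.Ioo 0 π) (u : E) :
    fderiv ℝ (fun y => ang (fun v => L v y) a b c) x u =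
      flux (cotAng fun v => L v x) (fun v => L v u) a b c := by
  have hm := cosAng_mem h
  have hs := sin_pos_of_pos_of_lt_pi h.1 h.2
  have hb := ((L b).hasFDerivAt (x := x))
  have hc := ((L c).hasFDerivAt (x := x))
  have ha := ((L a).hasFDerivAt (x := x))
  have hd : HasFDerivAt (fun y => cosAng (fun v => L v y) a b c) _ x :=
    (((hb.sub hc).exp.add (hc.sub hb).exp).sub ((hb.add hc).sub (ha.const_mul 2)).exp).mul_const
      (2 : ℝ)⁻¹
  have := ((hasDerivAt_arccos hm.1.ne' hm.2.ne).comp_hasFDerivAt x hd).fderiv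
  rw [show (fun y => ang (fun v => L v y) a b c) =
    arccos ∘ fun y => cosAng (fun v => L v y) a b c from rfl, this]
  have e1 := cotAng_mul_sin h
  have e2 := cotAng_mul_sin (by rwa [ang_comm] at h : ang (fun v => L v x) a c b ∈ Set.Ioo 0 π)
  rw [ang_comm, add_comm (L c x)] at e2
  rw [show √(1 - cosAng (fun v => L v x) a b c ^ 2) = sin (ang (fun v => L v x) a b c) from
    (sin_arccos _).symm]
  refine mul_left_cancel₀ hs.ne' ?_
  simp only [flux, smul_apply, add_apply, sub_apply, Pi.add_apply, Pi.sub_apply, smul_eq_mul]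
  rw [neg_mul, mul_neg, ← mul_assoc, mul_one_div_cancel hs.ne']
  linear_combination (-(L b u - L a u)) * e1 - (L c u - L a u) * e2

lemma strictTri_of_ang {n : ℕ} (hn : n ≠ 0) {w : ℤ × ℤ → ℝ} {a b c : ℤ × ℤ}
    (h : ang w a b c ∈ Set.Ioo 0 π) : StrictTri (el n w a b) (el n w a c) (el n w b c) := by
  have hp : ∀ p q, 0 < el n w p q := fun p q => by
    have : 0 < n := Nat.pos_of_ne_zero hn
    unfold el; positivity
  rw [← angAt_eq_ang hn, angAt, triAngle] at h
  have h1 := arccos_lt_pi.1 h.2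
  have h2 := arccos_pos.1 h.1
  have p1 := hp a b
  have p2 := hp a c
  have p3 := hp b c
  rw [lt_div_iff₀ (by positivity)] at h1
  rw [div_lt_one (by positivity)] at h2
  refine ⟨?_, ?_, ?_⟩ <;> nlinarith

lemma cot_nonneg {θ : ℝ} (h0 : 0 ≤ θ) (h1 : θ ≤ π / 2) : 0 ≤ cot θ := by
  rw [cot_eq_cos_div_sin]
  exact div_nonneg (cos_nonneg_of_neg_pi_div_two_le_of_le (by linarith) h1)
    (sin_nonneg_of_nonneg_of_le_pi h0 (by linarith [pi_pos]))

lemma pi_div_two_sub_le_cot {θ : ℝ} (h0 : 0 < θ) (h1 : θ ≤ π / 2) : π / 2 - θ ≤ cot θ := by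
  rw [← tan_inv_eq_cot, ← tan_pi_div_two_sub]
  exact le_tan (by linarith) (by linarith)

lemma cot_le_one {θ : ℝ} (h0 : π / 4 ≤ θ) (h1 : θ ≤ π / 2) : cot θ ≤ 1 := by
  have h2 := cos_le_cos_of_nonneg_of_le_pi (by positivity) (by linarith [pi_pos]) h0
  have h3 := sin_le_sin_of_le_of_le_pi_div_two (by linarith [pi_pos]) h1 h0
  rw [cos_pi_div_four] at h2
  rw [sin_pi_div_four] at h3
  rw [cot_eq_cos_div_sin]
  exact div_le_one_of_le₀ (h2.trans h3) (le_trans (by positivity) h3)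

lemma cot_le_two {θ : ℝ} (h0 : π / 6 ≤ θ) (h1 : θ ≤ π / 2) : cot θ ≤ 2 := by
  have h3 := sin_le_sin_of_le_of_le_pi_div_two (by linarith [pi_pos]) h1 h0
  rw [sin_pi_div_six] at h3
  rw [cot_eq_cos_div_sin, div_le_iff₀ (by linarith)]
  linarith [cos_le_one θ]

end Angle

section AngleControl

/-- The upper bound imposed on the angles at `v`. -/
noncomputable def angleBound (v : ℤ × ℤ) : ℝ := if v = (0, 0) then π / 2 else 59 * π / 120

/-- All angles lie between `π / 6` and `angleBound`. -/
def AnglesControlled (n : ℕ) (w : ℤ × ℤ → ℝ) : Prop :=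
  ∀ t ∈ tris n, ang w t.1 t.2.1 t.2.2 ∈ Set.Icc (π / 6) (angleBound t.1) ∧
    ang w t.2.1 t.1 t.2.2 ∈ Set.Icc (π / 6) (angleBound t.2.1) ∧
    ang w t.2.2 t.1 t.2.1 ∈ Set.Icc (π / 6) (angleBound t.2.2)

lemma angleBound_le (v : ℤ × ℤ) : angleBound v ≤ π / 2 := by
  rw [angleBound]; split_ifs <;> linarith [pi_pos]

variable {n : ℕ} {w U φ : ℤ × ℤ → ℝ} {κ : ℤ × ℤ → ℤ × ℤ → ℤ × ℤ → ℝ} {m : ℝ}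

namespace AnglesControlled

lemma mem_Icc (h : AnglesControlled n w) {v y z : ℤ × ℤ} (hc : CornerOf n v y z) :
    ang w v y z ∈ Set.Icc (π / 6) (angleBound v) := by
  rcases hc with ht | ht | ht <;> obtain ⟨h1, h2, h3⟩ := h _ ht
  exacts [h1, h2, h3]

lemma mem_Ioo (h : AnglesControlled n w) {v y z : ℤ × ℤ} (hc : CornerOf n v y z) :
    ang w v y z ∈ Set.Ioo 0 π := by
  have h1 := h.mem_Icc hc
  have h2 := angleBound_le v
  exact ⟨by linarith [h1.1, pi_pos], by linarith [h1.2, pi_pos]⟩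

lemma cotAng_nonneg (h : AnglesControlled n w) {v y z : ℤ × ℤ} (hc : CornerOf n v y z) :
    0 ≤ cotAng w v y z :=
  cot_nonneg (h.mem_Ioo hc).1.le ((h.mem_Icc hc).2.trans (angleBound_le v))

lemma cotAng_le_two (h : AnglesControlled n w) {v y z : ℤ × ℤ} (hc : CornerOf n v y z) :
    cotAng w v y z ≤ 2 :=
  cot_le_two (h.mem_Icc hc).1 ((h.mem_Icc hc).2.trans (angleBound_le v))

lemma le_cotAng (h : AnglesControlled n w) {v y z : ℤ × ℤ} (hc : CornerOf n v y z)
    (hv : v ≠ (0, 0)) : 1 / 40 ≤ cotAng w v y z := by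
  have h1 := (h.mem_Icc hc).2
  rw [angleBound, if_neg hv] at h1
  have := pi_div_two_sub_le_cot (h.mem_Ioo hc).1 (by linarith [pi_pos])
  rw [cotAng]
  linarith [pi_gt_three]

lemma le_cotAng_of_mem_tris (h : AnglesControlled n w) (x y z : ℤ × ℤ) (ht : (x, y, z) ∈ tris n) :
    1 / 40 ≤ cotAng w y x z ∧ 1 / 40 ≤ cotAng w z x y :=
  ⟨h.le_cotAng (Or.inr (Or.inl ht)) (ne_zero_of_mem_tris ht).1,
    h.le_cotAng (Or.inr (Or.inr ht)) (ne_zero_of_mem_tris ht).2⟩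

end AnglesControlled

lemma sum_mul_cornerSum_flux (hκ : ∀ a b c, κ a b c = κ a c b) :
    ∑ v ∈ verts n, φ v * cornerSum n (flux κ U) v =
      -∑ t ∈ tris n, energy κ U φ t.1 t.2.1 t.2.2 := by
  rw [sum_mul_cornerSum, ← Finset.sum_neg_distrib]
  refine Finset.sum_congr rfl fun t _ => ?_
  rw [energy, flux, flux, flux, hκ t.2.2 t.2.1, hκ t.2.1 t.2.2, hκ t.1 t.2.2]
  ring

lemma flux_comm (a b c : ℤ × ℤ) :
    flux κ U a b c = flux κ U a c b := by
  rw [flux, flux, add_comm]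

/-- A potential for which all free vertices but the apex are in balance is the potential of a
flow. -/
lemma AnglesControlled.isFlow (h : AnglesControlled n w) (hw : ∀ v, w v.swap = w v)
    (hU : ∀ v, U v.swap = U v) (hU0 : ∀ v : ℤ × ℤ, v.1 + v.2 = n → U v = 0) (hm : 0 ≤ m)
    (hflux : ∀ v, inV n v → v.1 + v.2 ≠ n →
      cornerSum n (flux (cotAng w) U) v = if v = (0, 0) then -m else 0) :
    IsFlow n (cotAng w) U m where
  comm := cotAng_comm w
  weight_nonneg a b c ht := h.cotAng_nonneg (Or.inl ht)
  weight_pos a b c ht := by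
    have := h.le_cotAng_of_mem_tris a b c ht
    constructor <;> linarith
  boundary := hU0
  strength := hm
  weak φ hφ := by
    have h1 := sum_mul_cornerSum_flux (n := n) (U := U) (φ := φ) (cotAng_comm w)
    have h2 : ∑ v ∈ verts n, φ v * cornerSum n (flux (cotAng w) U) v =
        ∑ v ∈ verts n, if v = (0, 0) then -(m * φ (0, 0)) else 0 := by
      refine Finset.sum_congr rfl fun v hv => ?_
      by_cases hvn : v.1 + v.2 = n
      · rw [hφ v hvn, zero_mul]
        split_ifs with h0
        · rw [← h0, hφ v hvn, mul_zero, neg_zero]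
        · rfl
      · rw [hflux v (mem_verts.1 hv) hvn]
        split_ifs with h0
        · rw [h0]; ring
        · rw [mul_zero]
    rw [Finset.sum_ite_eq', if_pos (mem_verts.2 (by simp [inV]))] at h2
    linarith
  weight_swap a b c := by rw [cotAng, cotAng, ang_swap hw]
  potential_swap := hU

end AngleControl

section StateSpace

/-- The representative of a vertex under the reflection in the symmetry axis. -/
def fold (v : ℤ × ℤ) : ℤ × ℤ := if v.2 ≤ v.1 then v else v.swap

/-- Representatives of the vertices off the side opposite to the apex. -/
noncomputable def freeVerts (n : ℕ) : Finset (ℤ × ℤ) :=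
  (verts n).filter fun v => v.2 ≤ v.1 ∧ v.1 + v.2 ≠ n

/-- The value at `v` of the symmetric conformal factor which is given by its values on `freeVerts`
and vanishes on the side opposite to the apex. -/
noncomputable def extend (n : ℕ) (v : ℤ × ℤ) : (freeVerts n → ℝ) →L[ℝ] ℝ :=
  if h : fold v ∈ freeVerts n then ContinuousLinearMap.proj ⟨fold v, h⟩ else 0

/-- The angle sums at the vertices in `freeVerts`. -/
noncomputable def angleSums (n : ℕ) (x : freeVerts n → ℝ) (q : freeVerts n) : ℝ :=
  cornerSum n (ang fun v => extend n v x) q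

/-- The vector field which changes the angle sum at the apex with rate `β`. -/
noncomputable def angleField (n : ℕ) (β : ℝ) (x : freeVerts n → ℝ) : freeVerts n → ℝ :=
  (fderiv ℝ (angleSums n) x).inverse fun q => if (q : ℤ × ℤ) = (0, 0) then β else 0

variable {n : ℕ} {x : freeVerts n → ℝ} {β : ℝ}

lemma mem_freeVerts {v : ℤ × ℤ} : v ∈ freeVerts n ↔ inV n v ∧ v.2 ≤ v.1 ∧ v.1 + v.2 ≠ n := by
  rw [freeVerts, Finset.mem_filter, mem_verts]

lemma fold_swap (v : ℤ × ℤ) : fold v.swap = fold v := by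
  simp only [fold, Prod.swap]
  split_ifs with h1 h2 h2
  · ext <;> simp <;> omega
  · rfl
  · rfl
  · omega

lemma extend_swap (v : ℤ × ℤ) (x : freeVerts n → ℝ) : extend n v.swap x = extend n v x := by
  simp only [extend, fold_swap]

lemma extend_boundary {v : ℤ × ℤ} (hv : v.1 + v.2 = n) (x : freeVerts n → ℝ) :
    extend n v x = 0 := by
  rw [extend, dif_neg]
  · rfl
  · rw [mem_freeVerts, fold]
    split_ifs
    · tauto
    · rintro ⟨-, -, h⟩
      exact h (by rw [← hv]; simp [add_comm])

lemma extend_apply (q : freeVerts n) (x : freeVerts n → ℝ) : extend n q x = x q := by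
  have hq := q.2
  have hf : fold q = q := if_pos (mem_freeVerts.1 hq).2.1
  simp only [extend, hf, hq, dif_pos]
  rfl

lemma exists_freeVerts {v : ℤ × ℤ} (hv : inV n v) (hvn : v.1 + v.2 ≠ n) :
    ∃ q : freeVerts n, (q : ℤ × ℤ) = v ∨ (q : ℤ × ℤ) = v.swap := by
  rcases le_total v.2 v.1 with h | h
  · exact ⟨⟨v, mem_freeVerts.2 ⟨hv, h, hvn⟩⟩, Or.inl rfl⟩
  · refine ⟨⟨v.swap, mem_freeVerts.2 ⟨?_, h, ?_⟩⟩, Or.inr rfl⟩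
    · simp only [inV, Prod.swap] at *; omega
    · simp only [Prod.swap] at *; omega

lemma hasFDerivAt_cornerSum (h : AnglesControlled n fun v => extend n v x) (v : ℤ × ℤ) :
    ∃ D : (freeVerts n → ℝ) →L[ℝ] ℝ,
      HasFDerivAt (fun y => cornerSum n (ang fun v => extend n v y) v) D x ∧
      ∀ u, D u = cornerSum n (flux (cotAng fun v => extend n v x) fun v => extend n v u) v := by
  have key : ∀ a b c, CornerOf n a b c → HasFDerivAt
      (fun y => if a = v then ang (fun v => extend n v y) a b c else 0)
      (if a = v then fderiv ℝ (fun y => ang (fun v => extend n v y) a b c) x else 0) x := by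
    intro a b c hc
    split_ifs
    · exact ((contDiffAt_ang (extend n) (h.mem_Ioo hc)).differentiableAt (by norm_num)).hasFDerivAt
    · exact hasFDerivAt_const _ _
  refine ⟨_, HasFDerivAt.fun_sum fun t ht => ((key _ _ _ (Or.inl ht)).add
    (key _ _ _ (Or.inr (Or.inl ht)))).add (key _ _ _ (Or.inr (Or.inr ht))), fun u => ?_⟩
  rw [sum_apply, cornerSum]
  refine Finset.sum_congr rfl fun t ht => ?_
  have key2 : ∀ a b c, CornerOf n a b c →
      (if a = v then fderiv ℝ (fun y => ang (fun v => extend n v y) a b c) x else 0) u =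
      if a = v then flux (cotAng fun v => extend n v x) (fun v => extend n v u) a b c else 0 := by
    intro a b c hc
    split_ifs
    · exact fderiv_ang (extend n) (h.mem_Ioo hc) u
    · rfl
  rw [add_apply, add_apply, key2 _ _ _ (Or.inl ht), key2 _ _ _ (Or.inr (Or.inl ht)),
    key2 _ _ _ (Or.inr (Or.inr ht))]

lemma contDiffAt_angleSums (h : AnglesControlled n fun v => extend n v x) :
    ContDiffAt ℝ 2 (angleSums n) x := by
  refine contDiffAt_pi.2 fun q => ?_
  have key : ∀ a b c, CornerOf n a b c → ContDiffAt ℝ 2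
      (fun y => if a = (q : ℤ × ℤ) then ang (fun v => extend n v y) a b c else 0) x := by
    intro a b c hc
    split_ifs
    · exact contDiffAt_ang (extend n) (h.mem_Ioo hc)
    · exact contDiffAt_const
  exact ContDiffAt.sum fun t ht => ((key _ _ _ (Or.inl ht)).add
    (key _ _ _ (Or.inr (Or.inl ht)))).add (key _ _ _ (Or.inr (Or.inr ht)))

lemma fderiv_angleSums (h : AnglesControlled n fun v => extend n v x) (u : freeVerts n → ℝ)
    (q : freeVerts n) : fderiv ℝ (angleSums n) x u q =
      cornerSum n (flux (cotAng fun v => extend n v x) fun v => extend n v u) q := by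
  obtain ⟨D, hD, hDu⟩ := hasFDerivAt_cornerSum h q
  have h1 := ((contDiffAt_angleSums h).differentiableAt (by norm_num)).hasFDerivAt
  rw [← hDu, hD.unique (hasFDerivAt_pi'.1 h1 q)]
  rfl

lemma cornerSum_flux_swap (u : freeVerts n → ℝ) (v : ℤ × ℤ) :
    cornerSum n (flux (cotAng fun v => extend n v x) fun v => extend n v u) v.swap =
      cornerSum n (flux (cotAng fun v => extend n v x) fun v => extend n v u) v :=
  cornerSum_swap _ _ flux_comm (fun a b c => by
    simp only [flux, cotAng, ang_swap (w := fun v => extend n v x) (fun v => extend_swap v x),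
      extend_swap]) v

lemma isInvertible_fderiv_angleSums (h : AnglesControlled n fun v => extend n v x) :
    (fderiv ℝ (angleSums n) x).IsInvertible := by
  have hinj : Function.Injective (fderiv ℝ (angleSums n) x) := by
    rw [injective_iff_map_eq_zero]
    intro u hu
    have hflow : IsFlow n (cotAng fun v => extend n v x) (fun v => extend n v u) 0 := by
      refine h.isFlow (fun v => extend_swap v x) (fun v => extend_swap v u)
        (fun v hv => extend_boundary hv u) le_rfl fun v hv hvn => ?_
      obtain ⟨q, hq⟩ := exists_freeVerts hv hvn
      have h0 := fderiv_angleSums h u q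
      rw [hu] at h0
      rcases hq with hq | hq
      · rw [← hq, ← h0]; simp
      · rw [← cornerSum_flux_swap, ← hq, ← h0]; simp
    funext q
    rw [← extend_apply q u]
    exact hflow.eq_zero hflow.boundary (by simp) (fun x y _ _ _ _ =>
      ⟨mul_self_nonneg _, fun h => sub_eq_zero.1 (mul_self_eq_zero.1 h)⟩) (mem_freeVerts.1 q.2).1
  exact ⟨(LinearEquiv.ofInjectiveEndo _ hinj).toContinuousLinearEquiv, by ext; rfl⟩

lemma contDiffAt_angleField (h : AnglesControlled n fun v => extend n v x) :
    ContDiffAt ℝ 1 (angleField n β) x := by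
  have h1 : ContDiffAt ℝ 1 (fun y => (fderiv ℝ (angleSums n) y).inverse) x :=
    ((isInvertible_fderiv_angleSums h).contDiffAt_map_inverse).comp x
      ((contDiffAt_angleSums h).fderiv_right (by norm_num))
  exact h1.clm_apply contDiffAt_const

lemma cornerSum_flux_angleField (h : AnglesControlled n fun v => extend n v x) {v : ℤ × ℤ}
    (hv : inV n v) (hvn : v.1 + v.2 ≠ n) :
    cornerSum n (flux (cotAng fun v => extend n v x) fun v => extend n v (angleField n β x)) v =
      if v = (0, 0) then β else 0 := by
  obtain ⟨q, hq⟩ := exists_freeVerts hv hvn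
  have h0 := fderiv_angleSums h (angleField n β x) q
  rw [angleField, (isInvertible_fderiv_angleSums h).self_apply_inverse] at h0
  rcases hq with hq | hq
  · rw [← hq]; exact h0.symm
  · rw [← cornerSum_flux_swap, ← hq]
    refine h0.symm.trans ?_
    rw [hq]
    have : v.swap = (0, 0) ↔ v = (0, 0) := by
      rw [← Prod.swap_inj (p := v)]; rfl
    simp only [this]

end StateSpace

section Compactness

variable {n : ℕ}

/-- The conformal factors with controlled angles. -/
def controlledSet (n : ℕ) : Set (freeVerts n → ℝ) :=
  {x | AnglesControlled n fun v => extend n v x}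

lemma continuous_ang_extend (a b c : ℤ × ℤ) :
    Continuous fun x : freeVerts n → ℝ => ang (fun v => extend n v x) a b c := by
  refine continuous_arccos.comp ?_
  unfold cosAng
  fun_prop

lemma isClosed_controlledSet (n : ℕ) : IsClosed (controlledSet n) := by
  simp only [controlledSet, AnglesControlled, Set.ofPred_forall]
  exact isClosed_biInter fun t _ => (isClosed_Icc.preimage (continuous_ang_extend _ _ _)).inter
    ((isClosed_Icc.preimage (continuous_ang_extend _ _ _)).inter
      (isClosed_Icc.preimage (continuous_ang_extend _ _ _)))

lemma mem_interior_controlledSet {x : freeVerts n → ℝ}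
    (h : ∀ v y z, CornerOf n v y z →
      ang (fun v => extend n v x) v y z ∈ Set.Ioo (π / 6) (angleBound v)) :
    x ∈ interior (controlledSet n) := by
  rw [mem_interior_iff_mem_nhds]
  have key : ∀ v y z, CornerOf n v y z → ∀ᶠ x' in nhds x,
      ang (fun v => extend n v x') v y z ∈ Set.Icc (π / 6) (angleBound v) := fun v y z hc =>
    (continuous_ang_extend v y z).continuousAt (Icc_mem_nhds (h v y z hc).1 (h v y z hc).2)
  exact (Filter.eventually_all_finset _).2 fun t ht =>
    (key _ _ _ (Or.inl ht)).and
      ((key _ _ _ (Or.inr (Or.inl ht))).and (key _ _ _ (Or.inr (Or.inr ht))))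

lemma AnglesControlled.sub_le_one {w : ℤ × ℤ → ℝ} (h : AnglesControlled n w) {v y z : ℤ × ℤ}
    (hc : CornerOf n v y z) : w v - w y ≤ 1 ∧ w v - w z ≤ 1 := by
  have h1 := h.mem_Icc hc
  have h2 := sin_le_sin_of_le_of_le_pi_div_two (by linarith [pi_pos])
    (h1.2.trans (angleBound_le v)) h1.1
  rw [sin_pi_div_six] at h2
  have key : ∀ y z, 1 / 2 ≤ sin (ang w v y z) → w v - w z ≤ 1 := by
    intro y z h2
    rw [sin_ang] at h2
    have h3 := h2.trans (mul_le_of_le_one_right (exp_pos _).le (sin_le_one _))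
    have h4 := add_one_le_exp (w v - w z)
    have h5 : exp (w z - w v) * exp (w v - w z) = 1 := by rw [← exp_add]; simp
    nlinarith [exp_pos (w v - w z)]
  exact ⟨key z y (by rwa [ang_comm]), key y z h2⟩

lemma AnglesControlled.abs_le {w : ℤ × ℤ → ℝ} (h : AnglesControlled n w)
    (hw : ∀ v : ℤ × ℤ, v.1 + v.2 = n → w v = 0) {v : ℤ × ℤ} (hv : inV n v) : |w v| ≤ n := by
  have key : ∀ k : ℕ, ∀ v : ℤ × ℤ, inV n v → v.1 + v.2 + k = n → |w v| ≤ k := by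
    intro k
    induction k with
    | zero =>
      intro v _ hk
      rw [hw v (by simpa using hk)]; simp
    | succ k ih =>
      intro v hv hk
      push_cast at hk
      have hd : validDown n v := by simp only [inV, validDown] at *; omega
      have ht := down_mem_tris hd
      have hb := ih (v + (0, 1)) (inV_of_mem_tris ht).2.2
        (by simp only [Prod.fst_add, Prod.snd_add]; omega)
      have e1 := (h.sub_le_one (Or.inl ht)).2
      have e2 := (h.sub_le_one (Or.inr (Or.inr ht))).1
      rw [_root_.abs_le] at hb ⊢
      push_cast
      constructor <;> linarith
  obtain ⟨k, hk⟩ := Int.eq_ofNat_of_zero_le (show 0 ≤ n - v.1 - v.2 by have := hv.2.2; omega)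
  refine (key k v hv (by omega)).trans ?_
  exact_mod_cast (by have := hv.1; have := hv.2.1; omega : (k : ℤ) ≤ n)

lemma isCompact_controlledSet (n : ℕ) : IsCompact (controlledSet n) := by
  refine Metric.isCompact_of_isClosed_isBounded (isClosed_controlledSet n)
    ((Metric.isBounded_closedBall (x := 0) (r := n)).subset fun x hx => ?_)
  rw [mem_closedBall_zero_iff, pi_norm_le_iff_of_nonneg n.cast_nonneg]
  intro q
  rw [← extend_apply q x, norm_eq_abs]
  exact AnglesControlled.abs_le hx (fun v hv => extend_boundary hv x) (mem_freeVerts.1 q.2).1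

lemma zero_mem_controlledSet (n : ℕ) : (0 : freeVerts n → ℝ) ∈ controlledSet n := by
  have h : ∀ v, π / 3 ∈ Set.Icc (π / 6) (angleBound v) := fun v => by
    refine ⟨by linarith [pi_pos], ?_⟩
    rw [angleBound]
    split_ifs <;> linarith [pi_pos]
  have h0 : (fun v => extend n v 0) = 0 := by funext v; simp
  intro t _
  simp only [h0, ang_zero]
  exact ⟨h _, h _, h _⟩

end Compactness

section Evolution

variable {n : ℕ} {β : ℝ} {x : ℝ → freeVerts n → ℝ}

lemma exists_sign (β : ℝ) : ∃ ε : ℝ, |ε| = 1 ∧ ε * β = -|β| := by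
  rcases le_total 0 β with h | h
  · exact ⟨-1, by simp, by rw [abs_of_nonneg h]; ring⟩
  · exact ⟨1, by simp, by rw [abs_of_nonpos h]; ring⟩

lemma flux_const_mul {κ : ℤ × ℤ → ℤ × ℤ → ℤ × ℤ → ℝ} {u : ℤ × ℤ → ℝ} (ε : ℝ) (v y z : ℤ × ℤ) :
    flux κ (fun v => ε * u v) v y z = ε * flux κ u v y z := by
  simp only [flux]; ring

lemma cornerSum_const_mul (f : ℤ × ℤ → ℤ × ℤ → ℤ × ℤ → ℝ) (ε : ℝ) (v : ℤ × ℤ) :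
    cornerSum n (fun a b c => ε * f a b c) v = ε * cornerSum n f v := by
  simp only [cornerSum, Finset.mul_sum, mul_add, mul_ite, mul_zero]

/-- The vector field `angleField` is up to sign the potential of a flow of strength `|β|`. -/
lemma isFlow_angleField {y : freeVerts n → ℝ} (hy : y ∈ controlledSet n) {ε : ℝ}
    (hε : ε * β = -|β|) : IsFlow n (cotAng fun v => extend n v y)
      (fun v => ε * extend n v (angleField n β y)) |β| := by
  refine AnglesControlled.isFlow hy (fun v => extend_swap v y) (fun v => ?_) (fun v hv => ?_)
    (abs_nonneg β) fun v hv hvn => ?_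
  · rw [extend_swap]
  · rw [extend_boundary hv, mul_zero]
  · have : flux (cotAng fun v => extend n v y) (fun v => ε * extend n v (angleField n β y)) =
        fun a b c => ε * flux (cotAng fun v => extend n v y)
          (fun v => extend n v (angleField n β y)) a b c := by
      funext a b c; exact flux_const_mul ε a b c
    rw [this, cornerSum_const_mul, cornerSum_flux_angleField hy hv hvn, mul_ite, mul_zero, hε]

lemma abs_flux_of_sign {κ : ℤ × ℤ → ℤ × ℤ → ℤ × ℤ → ℝ} {u : ℤ × ℤ → ℝ} {ε : ℝ} (hε : |ε| = 1)
    (v y z : ℤ × ℤ) : |flux κ u v y z| = |flux κ (fun v => ε * u v) v y z| := by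
  rw [flux_const_mul, abs_mul, hε, one_mul]

lemma abs_sub_le_of_deriv_le {f f' : ℝ → ℝ} {C s : ℝ} (hs : s ∈ Set.Icc (0 : ℝ) 1)
    (hf : ∀ t ∈ Set.Icc 0 s, HasDerivWithinAt f (f' t) (Set.Icc 0 1) t)
    (hC : ∀ t ∈ Set.Icc 0 s, |f' t| ≤ C) : |f s - f 0| ≤ C * s := by
  simpa using norm_image_sub_le_of_norm_deriv_le_segment' (fun t ht =>
    (hf t ht).mono (Set.Icc_subset_Icc_right hs.2)) (fun t ht => hC t (Set.Ico_subset_Icc_self ht))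
    s (Set.right_mem_Icc.2 hs.1)

/-- `x` solves the differential equation given by `angleField` as long as the angles are
controlled. -/
structure IsEvolution (n : ℕ) (β : ℝ) (x : ℝ → freeVerts n → ℝ) : Prop where
  zero : x 0 = 0
  deriv : ∀ t ∈ Set.Icc (0 : ℝ) 1, x t ∈ controlledSet n →
    HasDerivWithinAt x (angleField n β (x t)) (Set.Icc 0 1) t

namespace IsEvolution

lemma hasDerivWithinAt_ang (h : IsEvolution n β x) {t : ℝ} (ht : t ∈ Set.Icc (0 : ℝ) 1)
    (hx : x t ∈ controlledSet n) {v y z : ℤ × ℤ} (hc : CornerOf n v y z) :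
    HasDerivWithinAt (fun s => ang (fun v => extend n v (x s)) v y z)
      (flux (cotAng fun v => extend n v (x t)) (fun v => extend n v (angleField n β (x t))) v y z)
      (Set.Icc 0 1) t := by
  have hθ := AnglesControlled.mem_Ioo hx hc
  rw [← fderiv_ang (extend n) hθ]
  exact ((contDiffAt_ang (extend n) hθ).differentiableAt
    (by norm_num)).hasFDerivAt.comp_hasDerivWithinAt t (h.deriv t ht hx)

lemma ang_zero (h : IsEvolution n β x) (a b c : ℤ × ℤ) :
    ang (fun v => extend n v (x 0)) a b c = π / 3 := by
  have h0 : (fun v => extend n v (x 0)) = 0 := by funext v; simp [h.zero]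
  rw [h0, _root_.ang_zero]

lemma abs_ang_sub_le_of_flux (h : IsEvolution n β x) {s C : ℝ} (hs : s ∈ Set.Icc (0 : ℝ) 1)
    (hx : ∀ t ∈ Set.Icc 0 s, x t ∈ controlledSet n) {v y z : ℤ × ℤ} (hc : CornerOf n v y z)
    (hC : ∀ t ∈ Set.Icc 0 s, ∀ U : ℤ × ℤ → ℝ, IsFlow n (cotAng fun v => extend n v (x t)) U |β| →
      |flux (cotAng fun v => extend n v (x t)) U v y z| ≤ C) :
    |ang (fun v => extend n v (x s)) v y z - π / 3| ≤ C * s := by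
  obtain ⟨ε, hε, hεβ⟩ := exists_sign β
  rw [← h.ang_zero v y z]
  refine abs_sub_le_of_deriv_le (f := fun s => ang (fun v => extend n v (x s)) v y z) hs
    (fun t ht => h.hasDerivWithinAt_ang ⟨ht.1, ht.2.trans hs.2⟩ (hx t ht) hc) fun t ht => ?_
  rw [abs_flux_of_sign hε]
  exact hC t ht _ (isFlow_angleField (hx t ht) hεβ)

lemma abs_ang_sub_le (h : IsEvolution n β x) {s : ℝ} (hs : s ∈ Set.Icc (0 : ℝ) 1)
    (hx : ∀ t ∈ Set.Icc 0 s, x t ∈ controlledSet n) {v y z : ℤ × ℤ} (hc : CornerOf n v y z) :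
    |ang (fun v => extend n v (x s)) v y z - π / 3| ≤ |β| * s :=
  h.abs_ang_sub_le_of_flux hs hx hc fun _ _ _ hU => hU.abs_flux_le hc

lemma abs_ang_sub_le_half (h : IsEvolution n β x) {s : ℝ} (hs : s ∈ Set.Icc (0 : ℝ) 1)
    (hx : ∀ t ∈ Set.Icc 0 s, x t ∈ controlledSet n) {v y z : ℤ × ℤ} (hc : CornerOf n v y z)
    (hv : v.swap ≠ v ∨ (v, y, z) ∉ tris n) :
    |ang (fun v => extend n v (x s)) v y z - π / 3| ≤ |β| / 2 * s :=
  h.abs_ang_sub_le_of_flux hs hx hc fun _ _ _ hU => by linarith [hU.two_mul_abs_flux_le hc hv]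

lemma abs_ang_sub_le_of_ne (h : IsEvolution n β x) (hβ : |β| ≤ π / 6) {s : ℝ}
    (hs : s ∈ Set.Icc (0 : ℝ) 1) (hx : ∀ t ∈ Set.Icc 0 s, x t ∈ controlledSet n)
    {v y z : ℤ × ℤ} (hc : CornerOf n v y z) (hv : v ≠ (0, 0)) :
    |ang (fun v => extend n v (x s)) v y z - π / 3| ≤ 4 / 5 * |β| * s := by
  by_cases hvs : v.swap ≠ v ∨ (v, y, z) ∉ tris n
  · refine (h.abs_ang_sub_le_half hs hx hc hvs).trans (mul_le_mul_of_nonneg_right ?_ hs.1)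
    linarith [abs_nonneg β]
  · push Not at hvs
    refine h.abs_ang_sub_le_of_flux hs hx hc fun t ht U hU => ?_
    have := hU.five_mul_abs_flux_le (fun v' y' z' hc' hv' => ?_) hvs.2 hvs.1 hv
    · linarith
    · have h1 := h.abs_ang_sub_le_half ⟨ht.1, ht.2.trans hs.2⟩
        (fun τ hτ => hx τ ⟨hτ.1, hτ.2.trans ht.2⟩) hc' hv'
      have h2 : |β| / 2 * t ≤ π / 12 := by
        nlinarith [abs_nonneg β, ht.1, ht.2.trans hs.2]
      have h3 := abs_le.1 (h1.trans h2)
      have h4 := pi_div_two_sub_le_cot (θ := ang (fun v => extend n v (x t)) v' y' z')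
        (by linarith [pi_pos]) (by linarith [pi_pos])
      exact ⟨by rw [cotAng]; linarith [pi_gt_three],
        cot_le_one (by linarith) (by linarith [pi_pos])⟩

/-- The angles stay controlled up to time `1`. -/
lemma mem_controlledSet (h : IsEvolution n β x) (hβ : |β| ≤ π / 6)
    (hcont : ContinuousOn x (Set.Icc 0 1)) : ∀ t ∈ Set.Icc (0 : ℝ) 1, x t ∈ controlledSet n := by
  refine forall_mem_of_mem_interior hcont (isClosed_controlledSet n)
    (h.zero ▸ zero_mem_controlledSet n) fun s hs hx => mem_interior_controlledSet ?_
  intro v y z hc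
  have hs' := Set.Ico_subset_Icc_self hs
  have hπ := pi_pos
  rw [angleBound]
  split_ifs with hv
  · have h1 := h.abs_ang_sub_le hs' hx hc
    have h2 : |β| * s < π / 6 := by nlinarith [hs.1, hs.2]
    have h3 := abs_lt.1 (h1.trans_lt h2)
    exact ⟨by linarith, by linarith⟩
  · have h1 := h.abs_ang_sub_le_of_ne hβ hs' hx hc hv
    have h2 : 4 / 5 * |β| * s ≤ 2 * π / 15 := by nlinarith [hs.1, hs.2, abs_nonneg β]
    have h3 := abs_le.1 (h1.trans h2)
    exact ⟨by linarith, by linarith⟩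

end IsEvolution

end Evolution

section CornerSums

variable {n : ℕ} {f g : ℤ × ℤ → ℤ × ℤ → ℤ × ℤ → ℝ} {v : ℤ × ℤ}

lemma cornerSum_mono (h : ∀ y z, CornerOf n v y z → f v y z ≤ g v y z) :
    cornerSum n f v ≤ cornerSum n g v := by
  have key : ∀ a y z, CornerOf n a y z →
      (if a = v then f a y z else 0) ≤ if a = v then g a y z else 0 := by
    intro a y z hc
    split_ifs with ha
    · subst ha; exact h y z hc
    · exact le_rfl
  exact Finset.sum_le_sum fun t ht => add_le_add (add_le_add (key _ _ _ (Or.inl ht))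
    (key _ _ _ (Or.inr (Or.inl ht)))) (key _ _ _ (Or.inr (Or.inr ht)))

lemma cornerSum_zero : cornerSum n (fun _ _ _ => 0) v = 0 := by
  simp [cornerSum]

lemma cornerSum_nonneg (h : ∀ y z, CornerOf n v y z → 0 ≤ f v y z) : 0 ≤ cornerSum n f v :=
  cornerSum_zero.symm.trans_le (cornerSum_mono h)

lemma cornerSum_le_six_mul {C : ℝ} (hC : 0 ≤ C) (h : ∀ y z, CornerOf n v y z → f v y z ≤ C) :
    cornerSum n f v ≤ 6 * C := by
  refine (cornerSum_mono (g := fun _ _ _ => C) h).trans ?_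
  rw [cornerSum_eq n _ fun _ _ _ => rfl]
  have key : ∀ p : Prop, (if p then C else 0) ≤ C := fun p => by split_ifs <;> linarith
  linarith [key (validDown n v), key (validDown n (v - (1, 0))), key (validDown n (v - (0, 1))),
    key (validUp n (v - (1, 0))), key (validUp n (v - (0, 1))), key (validUp n (v - (1, 1)))]

lemma cornerSum_const_apex (hn : n ≠ 0) (C : ℝ) : cornerSum n (fun _ _ _ => C) (0, 0) = C := by
  rw [cornerSum_eq n _ fun _ _ _ => rfl, if_pos, if_neg, if_neg, if_neg, if_neg, if_neg]
  · ring
  all_goals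
    simp only [validDown, validUp, Prod.fst_sub, Prod.snd_sub]; omega

lemma cornerSum_const_boundary (hv : inV n v) (hv0 : v ≠ (0, 0)) (hvn : v.1 + v.2 ≠ n)
    (hb : isBdry n v) (C : ℝ) : cornerSum n (fun _ _ _ => C) v = 3 * C := by
  have h0 : v.1 = 0 ∧ 0 < v.2 ∨ 0 < v.1 ∧ v.2 = 0 := by
    simp only [inV, isBdry, ne_eq, Prod.ext_iff] at *; omega
  obtain ⟨-, -, hv⟩ := hv
  rw [cornerSum_eq n _ fun _ _ _ => rfl]
  rcases h0 with h0 | h0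
  · rw [if_pos, if_neg, if_pos, if_neg, if_pos, if_neg]
    · ring
    all_goals
      simp only [validDown, validUp, Prod.fst_sub, Prod.snd_sub]; omega
  · rw [if_pos, if_pos, if_neg, if_pos, if_neg, if_neg]
    · ring
    all_goals
      simp only [validDown, validUp, Prod.fst_sub, Prod.snd_sub]; omega

lemma cornerSum_const_interior (hv : inV n v) (hb : ¬ isBdry n v) (C : ℝ) :
    cornerSum n (fun _ _ _ => C) v = 6 * C := by
  simp only [inV, isBdry] at hv hb
  rw [cornerSum_eq n _ fun _ _ _ => rfl, if_pos, if_pos, if_pos, if_pos, if_pos, if_pos]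
  · ring
  all_goals
    simp only [validDown, validUp, Prod.fst_sub, Prod.snd_sub]; omega

lemma AnglesControlled.cotAng_le_two_of_cornerOf {w : ℤ × ℤ → ℝ} (h : AnglesControlled n w)
    {y z : ℤ × ℤ} (hc : CornerOf n v y z) : cotAng w y v z ≤ 2 ∧ cotAng w z v y ≤ 2 := by
  rcases hc with hc | hc | hc
  · exact ⟨h.cotAng_le_two (Or.inr (Or.inl hc)), h.cotAng_le_two (Or.inr (Or.inr hc))⟩
  · rw [cotAng_comm w z]
    exact ⟨h.cotAng_le_two (Or.inl hc), h.cotAng_le_two (Or.inr (Or.inr hc))⟩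
  · rw [cotAng_comm w y, cotAng_comm w z]
    exact ⟨h.cotAng_le_two (Or.inl hc), h.cotAng_le_two (Or.inr (Or.inl hc))⟩

lemma Kcurv_eq (hn : n ≠ 0) (w : ℤ × ℤ → ℝ) (v : ℤ × ℤ) :
    Kcurv n w v = (if isBdry n v then π else 2 * π) - cornerSum n (ang w) v := by
  rw [Kcurv, angSum, angAt_eq_ang hn, cornerSum_eq n (ang w) (ang_comm w)]
  split_ifs <;> rfl

end CornerSums

namespace IsEvolution

variable {n : ℕ} {β s : ℝ} {x : ℝ → freeVerts n → ℝ} {v : ℤ × ℤ}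

lemma cornerSum_ang_zero (h : IsEvolution n β x) (v : ℤ × ℤ) :
    cornerSum n (ang fun v => extend n v (x 0)) v = cornerSum n (fun _ _ _ => π / 3) v := by
  congr 1
  funext a b c
  exact h.ang_zero a b c

lemma hasDerivWithinAt_cornerSum (h : IsEvolution n β x) {t : ℝ} (ht : t ∈ Set.Icc (0 : ℝ) 1)
    (hx : x t ∈ controlledSet n) (v : ℤ × ℤ) :
    HasDerivWithinAt (fun s => cornerSum n (ang fun v => extend n v (x s)) v)
      (cornerSum n (flux (cotAng fun v => extend n v (x t))
        fun v => extend n v (angleField n β (x t))) v) (Set.Icc 0 1) t := by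
  obtain ⟨D, hD, hDu⟩ := hasFDerivAt_cornerSum hx v
  rw [← hDu]
  exact hD.comp_hasDerivWithinAt t (h.deriv t ht hx)

lemma cornerSum_ang_of_free (h : IsEvolution n β x) (hs : s ∈ Set.Icc (0 : ℝ) 1)
    (hx : ∀ t ∈ Set.Icc (0 : ℝ) 1, x t ∈ controlledSet n) (hv : inV n v) (hvn : v.1 + v.2 ≠ n) :
    cornerSum n (ang fun v => extend n v (x s)) v =
      cornerSum n (fun _ _ _ => π / 3) v + s * if v = (0, 0) then β else 0 := by
  have h1 := abs_sub_le_of_deriv_le (C := 0) hs (fun t ht =>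
    (h.hasDerivWithinAt_cornerSum ⟨ht.1, ht.2.trans hs.2⟩ (hx t ⟨ht.1, ht.2.trans hs.2⟩) v).sub
      ((hasDerivWithinAt_id t _).mul_const (if v = (0, 0) then β else 0))) fun t ht => by
    rw [cornerSum_flux_angleField (hx t ⟨ht.1, ht.2.trans hs.2⟩) hv hvn]
    simp
  rw [zero_mul, abs_nonpos_iff] at h1
  simp only [Pi.sub_apply, id, h.cornerSum_ang_zero] at h1
  linarith

lemma sum_cornerSum_ang (h : IsEvolution n β x) (hs : s ∈ Set.Icc (0 : ℝ) 1)
    (hx : ∀ t ∈ Set.Icc (0 : ℝ) 1, x t ∈ controlledSet n) :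
    ∑ v ∈ verts n, cornerSum n (ang fun v => extend n v (x s)) v =
      ∑ v ∈ verts n, cornerSum n (fun _ _ _ => π / 3) v := by
  have h1 := abs_sub_le_of_deriv_le (C := 0) hs (fun t ht => HasDerivWithinAt.fun_sum
    (u := verts n) fun v _ => h.hasDerivWithinAt_cornerSum ⟨ht.1, ht.2.trans hs.2⟩
      (hx t ⟨ht.1, ht.2.trans hs.2⟩) v) fun t ht => by
    have := sum_mul_cornerSum_flux (n := n) (U := fun v => extend n v (angleField n β (x t)))
      (φ := 1) (cotAng_comm fun v => extend n v (x t))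
    simp only [Pi.one_apply, one_mul] at this
    rw [this]
    simp [energy]
  rw [zero_mul, abs_nonpos_iff] at h1
  simp only [h.cornerSum_ang_zero] at h1
  linarith

lemma sum_side_cornerSum_ang (h : IsEvolution n β x) (hn : n ≠ 0) (hs : s ∈ Set.Icc (0 : ℝ) 1)
    (hx : ∀ t ∈ Set.Icc (0 : ℝ) 1, x t ∈ controlledSet n) :
    ∑ v ∈ (verts n).filter (fun v : ℤ × ℤ => v.1 + v.2 = n),
      (cornerSum n (ang fun v => extend n v (x s)) v - cornerSum n (fun _ _ _ => π / 3) v) =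
      -(s * β) := by
  have h1 := h.sum_cornerSum_ang hs hx
  rw [← sub_eq_zero, ← Finset.sum_sub_distrib,
    ← Finset.sum_filter_add_sum_filter_not _ fun v : ℤ × ℤ => v.1 + v.2 = n] at h1
  have h2 : ∑ v ∈ (verts n).filter (fun v : ℤ × ℤ => ¬ v.1 + v.2 = n),
      (cornerSum n (ang fun v => extend n v (x s)) v - cornerSum n (fun _ _ _ => π / 3) v) =
      ∑ v ∈ (verts n).filter (fun v : ℤ × ℤ => ¬ v.1 + v.2 = n),
        if v = (0, 0) then s * β else 0 := by
    refine Finset.sum_congr rfl fun v hv => ?_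
    rw [Finset.mem_filter, mem_verts] at hv
    rw [h.cornerSum_ang_of_free hs hx hv.1 hv.2, mul_ite, mul_zero, add_sub_cancel_left]
  rw [h2, Finset.sum_ite_eq', if_pos] at h1
  · linarith
  · rw [Finset.mem_filter, mem_verts]
    simp only [inV]
    omega

lemma flow_cornerSum (h : IsEvolution n β x) {ε : ℝ} (hεβ : ε * β = -|β|)
    (hx : ∀ t ∈ Set.Icc (0 : ℝ) 1, x t ∈ controlledSet n) (v : ℤ × ℤ) {t : ℝ}
    (ht : t ∈ Set.Icc (0 : ℝ) 1) : ∃ U, IsFlow n (cotAng fun v => extend n v (x t)) U |β| ∧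
      HasDerivWithinAt (fun s => ε * cornerSum n (ang fun v => extend n v (x s)) v)
        (cornerSum n (flux (cotAng fun v => extend n v (x t)) U) v) (Set.Icc 0 1) t := by
  refine ⟨_, isFlow_angleField (hx t ht) hεβ, ?_⟩
  have := (h.hasDerivWithinAt_cornerSum ht (hx t ht) v).const_mul ε
  rw [← cornerSum_const_mul] at this
  simpa only [← flux_const_mul] using this

lemma mul_cornerSum_sub_nonneg (h : IsEvolution n β x) {ε : ℝ} (hεβ : ε * β = -|β|)
    (hs : s ∈ Set.Icc (0 : ℝ) 1) (hx : ∀ t ∈ Set.Icc (0 : ℝ) 1, x t ∈ controlledSet n)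
    (hvn : v.1 + v.2 = n) :
    0 ≤ ε * (cornerSum n (ang fun v => extend n v (x s)) v -
      cornerSum n (fun _ _ _ => π / 3) v) := by
  choose! U hU hd using fun t ht => h.flow_cornerSum hεβ hx v (t := t) ht
  have := monotoneOn_of_hasDerivWithinAt_nonneg (convex_Icc (0 : ℝ) 1)
    (fun t ht => (hd t ht).continuousWithinAt)
    (fun t ht => (hd t (interior_subset ht)).mono interior_subset)
    (fun t ht => cornerSum_nonneg fun y z hc => (hU t (interior_subset ht)).flux_nonneg hc hvn)
    (Set.left_mem_Icc.2 zero_le_one) hs hs.1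
  simp only [h.cornerSum_ang_zero] at this
  linarith

lemma sum_abs_cornerSum_sub (h : IsEvolution n β x) (hn : n ≠ 0) (hs : s ∈ Set.Icc (0 : ℝ) 1)
    (hx : ∀ t ∈ Set.Icc (0 : ℝ) 1, x t ∈ controlledSet n) :
    ∑ v ∈ (verts n).filter (fun v : ℤ × ℤ => v.1 + v.2 = n),
      |cornerSum n (ang fun v => extend n v (x s)) v - cornerSum n (fun _ _ _ => π / 3) v| =
      s * |β| := by
  obtain ⟨ε, hε, hεβ⟩ := exists_sign β
  rw [← neg_eq_iff_eq_neg.2 hεβ, ← mul_neg, mul_left_comm, mul_neg,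
    ← h.sum_side_cornerSum_ang hn hs hx, Finset.mul_sum]
  refine Finset.sum_congr rfl fun v hv => ?_
  rw [← abs_of_nonneg (h.mul_cornerSum_sub_nonneg hεβ hs hx (Finset.mem_filter.1 hv).2), abs_mul,
    hε, one_mul]

lemma abs_cornerSum_sub_le_log (h : IsEvolution n β x) (hn : n ≠ 0) (hs : s ∈ Set.Icc (0 : ℝ) 1)
    (hx : ∀ t ∈ Set.Icc (0 : ℝ) 1, x t ∈ controlledSet n) (hvn : v.1 + v.2 = n)
    (hlog : 0 < Real.log (n / 2)) :
    |cornerSum n (ang fun v => extend n v (x s)) v - cornerSum n (fun _ _ _ => π / 3) v| ≤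
      1920 * |β| / Real.log (n / 2) := by
  obtain ⟨ε, hε, hεβ⟩ := exists_sign β
  choose! U hU hd using fun t ht => h.flow_cornerSum hεβ hx v (t := t) ht
  have h1 := abs_sub_le_of_deriv_le (C := 1920 * |β| / Real.log (n / 2)) hs
    (fun t ht => hd t ⟨ht.1, ht.2.trans hs.2⟩) fun t ht => by
    replace ht : t ∈ Set.Icc (0 : ℝ) 1 := ⟨ht.1, ht.2.trans hs.2⟩
    have hF := hU t ht
    have hxt : AnglesControlled n fun v => extend n v (x t) := hx t ht
    have hb : ∀ y, inV n y → |y.1 - v.1| ≤ 1 → |y.2 - v.2| ≤ 1 →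
        U t y ≤ 80 * |β| / Real.log (n / 2) := by
      intro y hy hy1 hy2
      have := hF.mul_log_le (Nat.one_le_iff_ne_zero.2 hn) (by norm_num)
        hxt.le_cotAng_of_mem_tris hvn hy hy1 hy2
      rw [le_div_iff₀ hlog]
      linarith
    rw [abs_of_nonneg (cornerSum_nonneg fun y z hc => hF.flux_nonneg hc hvn)]
    have hC : 0 ≤ 80 * |β| / Real.log (n / 2) := by positivity
    refine (cornerSum_le_six_mul (C := 4 * (80 * |β| / Real.log (n / 2))) (by positivity)
      fun y z hc => ?_).trans_eq (by ring)
    obtain ⟨-, hy, hz⟩ := hc.inV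
    have hnear : (|y.1 - v.1| ≤ 1 ∧ |y.2 - v.2| ≤ 1) ∧ (|z.1 - v.1| ≤ 1 ∧ |z.2 - v.2| ≤ 1) := by
      rcases hc with hc | hc | hc <;> obtain ⟨n1, n2, n3⟩ := near_of_mem_tris hc <;>
        simp only [abs_le] at * <;> omega
    obtain ⟨k1, k2⟩ := hxt.cotAng_le_two_of_cornerOf hc
    have b1 := hb y hy hnear.1.1 hnear.1.2
    have b2 := hb z hz hnear.2.1 hnear.2.2
    have u1 := hF.potential_nonneg hy
    have u2 := hF.potential_nonneg hz
    rw [flux, hF.boundary v hvn, sub_zero, sub_zero]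
    linarith [mul_le_mul k2 b1 u1 zero_le_two, mul_le_mul k1 b2 u2 zero_le_two]
  rw [← mul_sub, abs_mul, hε, one_mul, h.cornerSum_ang_zero] at h1
  exact h1.trans (mul_le_of_le_one_right (by positivity) hs.2)

end IsEvolution

section Conclusion

variable {n : ℕ} {w : ℤ × ℤ → ℝ}

lemma allAnglesIn_of_cornerOf (hn : n ≠ 0) {S : Set ℝ}
    (h : ∀ v y z, CornerOf n v y z → ang w v y z ∈ S) : AllAnglesIn n w S := by
  rw [AllAnglesIn, angAt_eq_ang hn]
  refine ⟨fun p hp => ?_, fun p hp => ?_⟩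
  · have ht := down_mem_tris hp
    exact ⟨h _ _ _ (Or.inl ht), h _ _ _ (Or.inr (Or.inl ht)), h _ _ _ (Or.inr (Or.inr ht))⟩
  · have ht := up_mem_tris hp
    rw [ang_comm w (p + (1, 0)), ang_comm w (p + (0, 1))]
    exact ⟨h _ _ _ (Or.inr (Or.inl ht)), h _ _ _ (Or.inr (Or.inr ht)), h _ _ _ (Or.inl ht)⟩

namespace AnglesControlled

lemma anglesAwayFromABounded (h : AnglesControlled n w) (hn : n ≠ 0) :
    AnglesAwayFromABounded n w (59 * π / 120) := by
  have key : ∀ v y z, CornerOf n v y z → v ≠ (0, 0) → ang w v y z ≤ 59 * π / 120 := by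
    intro v y z hc hv
    simpa only [angleBound, if_neg hv] using (h.mem_Icc hc).2
  rw [AnglesAwayFromABounded, angAt_eq_ang hn]
  refine ⟨fun p hp => ?_, fun p hp => ?_⟩
  · have ht := down_mem_tris hp
    exact ⟨key _ _ _ (Or.inl ht), key _ _ _ (Or.inr (Or.inl ht)), key _ _ _ (Or.inr (Or.inr ht))⟩
  · have ht := up_mem_tris hp
    rw [ang_comm w (p + (1, 0)), ang_comm w (p + (0, 1))]
    exact ⟨key _ _ _ (Or.inr (Or.inl ht)), key _ _ _ (Or.inr (Or.inr ht)), key _ _ _ (Or.inl ht)⟩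

lemma isPLMetric (h : AnglesControlled n w) (hn : n ≠ 0) : IsPLMetric n w := by
  refine ⟨fun p hp => strictTri_of_ang hn (h.mem_Ioo (Or.inl (down_mem_tris hp))),
    fun p hp => strictTri_of_ang hn ?_⟩
  rw [ang_comm]
  exact h.mem_Ioo (Or.inr (Or.inl (up_mem_tris hp)))

end AnglesControlled

lemma sum_range_eq_sum_side (n : ℕ) (f : ℤ × ℤ → ℝ) :
    ∑ i ∈ Finset.range (n + 1), f ((i : ℤ), (n : ℤ) - (i : ℤ)) =
      ∑ v ∈ (verts n).filter (fun v : ℤ × ℤ => v.1 + v.2 = n), f v := by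
  refine Finset.sum_nbij' (fun i : ℕ => ((i : ℤ), (n : ℤ) - (i : ℤ))) (fun v => v.1.toNat)
    ?_ ?_ ?_ ?_ ?_
  all_goals
    simp only [Finset.mem_range, Finset.mem_filter, mem_verts, inV, Prod.forall, Prod.mk.injEq,
      implies_true, Int.toNat_natCast]
  all_goals intros; omega

lemma le_two_thousand_div_sqrt_log (hn : 2 ≤ n) {a b : ℝ} (hb0 : 0 ≤ b) (hb : b ≤ π / 6)
    (ha : a ≤ b) (hlog : 0 < log (n / 2) → a ≤ 1920 * b / log (n / 2)) :
    a ≤ 2000 / √(log n) := by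
  have hn' : (2 : ℝ) ≤ n := by exact_mod_cast hn
  have hL : 0 < log n := log_pos (by linarith)
  have hr := sqrt_pos.2 hL
  have hsq := sq_sqrt hL.le
  have hπ := pi_lt_d2
  rcases le_or_gt (√(log n)) 2000 with h | h
  · refine (ha.trans hb).trans ?_
    rw [le_div_iff₀ hr]
    nlinarith
  · have hl2 := log_two_lt_d9
    rw [log_div (by linarith) two_ne_zero] at hlog
    have hlow : √(log n) * 1000 ≤ log n - log 2 := by nlinarith
    have hpos : 0 < log n - log 2 := by linarith
    refine (hlog hpos).trans ?_
    rw [div_le_div_iff₀ hpos hr]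
    nlinarith

end Conclusion

/-- (Theorem 5.4: deformation of the subdivided equilateral triangle.)  For `n ≥ 2` and
`α ∈ [π/6, π/2]` there is a continuously-differentiable family `w(t)`, `t ∈ [0,1]`, of
discrete conformal factors on the `n`-th standard subdivision with `w(0) = 0`, such
that for every `t ∈ [0,1]` the scaled metric is a PL metric with:
(a) `K_A = −tα + (2+t)π/3`; (b) zero curvature off `{A} ∪ V₀`; (c) `w(t) ≡ 0` on `V₀`;
(d) all inner angles in `[π/3 − |α−π/3|, π/3 + |α−π/3|]`; (e) inner angles at vertices
other than `A` at most `59π/120`; (f) `|K_v(t) − K_v(0)| ≤ 2000/√(ln n)` for `v ≠ A`,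
and `Σ_{v ∈ V₀} |K_v(t) − K_v(0)| ≤ π/6`. -/
theorem subdivided_triangle_deformation
    (n : ℕ) (hn : 2 ≤ n) (α : ℝ) (hα : α ∈ Set.Icc (π / 6) (π / 2)) :
    ∃ w : ℝ → (ℤ × ℤ → ℝ),
      (∀ v : ℤ × ℤ, ContDiffOn ℝ 1 (fun t => w t v) (Set.Icc (0 : ℝ) 1)) ∧
      w 0 = 0 ∧
      ∀ t ∈ Set.Icc (0 : ℝ) 1,
        IsPLMetric n (w t) ∧
        Kcurv n (w t) (0, 0) = -(t * α) + (2 + t) * (π / 3) ∧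
        (∀ v : ℤ × ℤ, inV n v → v ≠ (0, 0) → v.1 + v.2 ≠ (n : ℤ) →
          Kcurv n (w t) v = 0) ∧
        (∀ v : ℤ × ℤ, inV n v → v.1 + v.2 = (n : ℤ) → w t v = 0) ∧
        AllAnglesIn n (w t)
          (Set.Icc (π / 3 - |α - π / 3|) (π / 3 + |α - π / 3|)) ∧
        AnglesAwayFromABounded n (w t) (59 * π / 120) ∧
        (∀ v : ℤ × ℤ, inV n v → v ≠ (0, 0) →
          |Kcurv n (w t) v - Kcurv n (0 : ℤ × ℤ → ℝ) v| ≤ 2000 / Real.sqrt (Real.log n)) ∧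
        (∑ i ∈ Finset.range (n + 1),
            |Kcurv n (w t) ((i : ℤ), (n : ℤ) - (i : ℤ)) -
              Kcurv n (0 : ℤ × ℤ → ℝ) ((i : ℤ), (n : ℤ) - (i : ℤ))| ≤ π / 6) := by
  have hn0 : n ≠ 0 := by omega
  have hβ : |α - π / 3| ≤ π / 6 := abs_le.2 ⟨by linarith [hα.1], by linarith [hα.2]⟩
  set β := α - π / 3 with hβ_def
  obtain ⟨x, hx0, hxC, hxd⟩ := exists_integralCurve_of_isCompact (angleField n β)
    (isCompact_controlledSet n) (fun y hy => contDiffAt_angleField hy) 0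
  have h : IsEvolution n β x := ⟨hx0, hxd⟩
  have hx := h.mem_controlledSet hβ hxC.continuousOn
  have hK0 : ∀ v, Kcurv n 0 v =
      (if isBdry n v then π else 2 * π) - cornerSum n (fun _ _ _ => π / 3) v := by
    intro v
    rw [Kcurv_eq hn0]
    congr 2
    funext a b c
    exact ang_zero a b c
  refine ⟨fun t v => extend n v (x t), fun v => (extend n v).contDiff.comp_contDiffOn hxC,
    by funext v; simp [hx0], fun t ht => ?_⟩
  have hxt : AnglesControlled n fun v => extend n v (x t) := hx t ht
  have hK : ∀ v, |Kcurv n (fun v => extend n v (x t)) v - Kcurv n 0 v| =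
      |cornerSum n (ang fun v => extend n v (x t)) v - cornerSum n (fun _ _ _ => π / 3) v| := by
    intro v
    rw [Kcurv_eq hn0, hK0, sub_sub_sub_cancel_left, abs_sub_comm]
  have htβ : t * |β| ≤ |β| := mul_le_of_le_one_left (abs_nonneg _) ht.2
  have hsum := h.sum_abs_cornerSum_sub hn0 ht hx
  refine ⟨hxt.isPLMetric hn0, ?_, fun v hv hv0 hvn => ?_, fun v _ hvn => extend_boundary hvn _,
    allAnglesIn_of_cornerOf hn0 fun v y z hc => ?_, hxt.anglesAwayFromABounded hn0,
    fun v hv hv0 => ?_, ?_⟩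
  · rw [Kcurv_eq hn0, if_pos (show isBdry n (0, 0) from Or.inl rfl), h.cornerSum_ang_of_free ht hx
      (by simp [inV]) (by simp only; omega), cornerSum_const_apex hn0, if_pos rfl]
    ring
  · rw [Kcurv_eq hn0, h.cornerSum_ang_of_free ht hx hv hvn, if_neg hv0]
    split_ifs with hb
    · rw [cornerSum_const_boundary hv hv0 hvn hb]; ring
    · rw [cornerSum_const_interior hv hb]; ring
  · have h1 := h.abs_ang_sub_le ht (fun s hs => hx s ⟨hs.1, hs.2.trans ht.2⟩) hc
    rw [mul_comm] at h1
    replace h1 := abs_le.1 (h1.trans htβ)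
    exact ⟨by linarith [h1.1], by linarith [h1.2]⟩
  · rw [hK]
    by_cases hvn : v.1 + v.2 = n
    · refine le_two_thousand_div_sqrt_log hn (abs_nonneg β) hβ ?_
        fun hlog => h.abs_cornerSum_sub_le_log hn0 ht hx hvn hlog
      refine le_trans ?_ (hsum.trans_le htβ)
      exact Finset.single_le_sum (f := fun v => |cornerSum n (ang fun v => extend n v (x t)) v -
        cornerSum n (fun _ _ _ => π / 3) v|) (fun _ _ => abs_nonneg _)
        (Finset.mem_filter.2 ⟨mem_verts.2 hv, hvn⟩)
    · rw [h.cornerSum_ang_of_free ht hx hv hvn, if_neg hv0]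
      simp only [mul_zero, add_zero, sub_self, abs_zero]
      positivity
  · simp only [hK]
    rw [sum_range_eq_sum_side n fun v => |cornerSum n (ang fun v => extend n v (x t)) v -
      cornerSum n (fun _ _ _ => π / 3) v|, hsum]
    exact htβ.trans hβ
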